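/- Let n ≥ 2 and 1 ≤ k ≤ n−1 be integers, let 0 ≤ p < 2k be a real number, and let γ > 0 be a constant. Then the equation σ_k(A[φ]) = φ^{p−k} γ on 𝕊ⁿ has a unique even, uniformly h-convex solution, and this solution is a constant φ = c > 1. -/

import Mathlib

open scoped RealInnerProductSpace
open Finset

noncomputable section

/-- Euclidean space `ℝ^(n+1)`, the ambient space of the unit sphere `𝕊ⁿ`. -/
abbrev Euc (n : ℕ) : Type := EuclideanSpace ℝ (Fin (n + 1))

/-- The unit sphere `𝕊ⁿ ⊆ ℝ^(n+1)`. -/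
def uSphere (n : ℕ) : Set (Euc n) := Metric.sphere (0 : Euc n) 1

/-- Orthogonal projection onto the tangent space of the sphere at (the normalization of) `x`. -/
def tanProj {n : ℕ} (x v : Euc n) : Euc n := v - (⟪x, v⟫ / ‖x‖ ^ 2) • x

/-- `f` is (the 0-homogeneous extension of) a function on the sphere. -/
def Homog0 {n : ℕ} (f : Euc n → ℝ) : Prop := ∀ (c : ℝ) (y : Euc n), 0 < c → f (c • y) = f y

/-- Smoothness of a function on the sphere, expressed via its 0-homogeneous extension. -/
def SmoothFn {n : ℕ} (f : Euc n → ℝ) : Prop := ContDiffOn ℝ (⊤ : ℕ∞) f {y : Euc n | y ≠ 0}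

/-- `f(x) = f(-x)` for all `x`. -/
def EvenFn {n : ℕ} (f : Euc n → ℝ) : Prop := ∀ y, f (-y) = f y

/-- Covariant (tangential) derivative of a function on the sphere, in direction `v`. -/
def covD {n : ℕ} (f : Euc n → ℝ) (x v : Euc n) : ℝ := fderiv ℝ f x (tanProj x v)

/-- Spherical (tangential) gradient. -/
def gradS {n : ℕ} (f : Euc n → ℝ) (x : Euc n) : Euc n := tanProj x (gradient f x)

/-- Covariant Hessian `(D²f)(v,w)` of a function on the round sphere. -/
def hessS {n : ℕ} (f : Euc n → ℝ) (x v w : Euc n) : ℝ :=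
  fderiv ℝ (fun y => covD f y w) x (tanProj x v)

/-- The symmetric 2-tensor
`A[φ](v,w) = (D²φ)(v,w) - (|Dφ|²/(2φ)) σ(v,w) + ((φ - 1/φ)/2) σ(v,w)` on the sphere. -/
def Aform {n : ℕ} (φ : Euc n → ℝ) (x v w : Euc n) : ℝ :=
  hessS φ x v w +
    ((φ x - (φ x)⁻¹) / 2 - ‖gradS φ x‖ ^ 2 / (2 * φ x)) * ⟪tanProj x v, tanProj x w⟫

/-- `φ` is h-convex: `A[φ] ≥ 0` on the sphere. -/
def HConvex {n : ℕ} (φ : Euc n → ℝ) : Prop :=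
  ∀ x ∈ uSphere n, ∀ v : Euc n, ⟪x, v⟫ = 0 → 0 ≤ Aform φ x v v

/-- `φ` is uniformly h-convex: `A[φ] > 0` on the sphere. -/
def UnifHConvex {n : ℕ} (φ : Euc n → ℝ) : Prop :=
  ∀ x ∈ uSphere n, ∀ v : Euc n, ⟪x, v⟫ = 0 → v ≠ 0 → 0 < Aform φ x v v

/-- `σ_k` of a square matrix: the sum of its principal `k × k` minors
(equivalently, the `k`-th elementary symmetric function of its eigenvalues). -/
def sigmaMat {N : ℕ} (k : ℕ) (M : Matrix (Fin N) (Fin N) ℝ) : ℝ :=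
  ∑ s ∈ Finset.powersetCard k (Finset.univ : Finset (Fin N)),
    Matrix.det (Matrix.of fun i j : {a : Fin N // a ∈ s} => M i.1 j.1)

/-- `e` is an orthonormal frame of the tangent space of `𝕊ⁿ` at `x`. -/
def OrthoFrame {n : ℕ} (x : Euc n) (e : Fin n → Euc n) : Prop :=
  (∀ i, ⟪x, e i⟫ = 0) ∧ ∀ i j, ⟪e i, e j⟫ = if i = j then 1 else 0

/-- The matrix of `A[φ]` at `x` with respect to an orthonormal tangent frame `e`. -/
def Amat {n : ℕ} (φ : Euc n → ℝ) (x : Euc n) (e : Fin n → Euc n) : Matrix (Fin n) (Fin n) ℝ :=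
  Matrix.of fun i j => Aform φ x (e i) (e j)

/-- `φ` solves the horospherical `p`-Christoffel-Minkowski equation
`σ_k(A[φ]) = φ^(p-k) f` on `𝕊ⁿ`. -/
def SolvesCM (n k : ℕ) (p : ℝ) (f φ : Euc n → ℝ) : Prop :=
  ∀ x ∈ uSphere n, ∀ e : Fin n → Euc n, OrthoFrame x e →
    sigmaMat k (Amat φ x e) = φ x ^ (p - (k : ℝ)) * f x

/-- Supremum (maximum) of a function over the sphere. -/
def sphSup {n : ℕ} (f : Euc n → ℝ) : ℝ := sSup (f '' uSphere n)

/-- Infimum (minimum) of a function over the sphere. -/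
def sphInf {n : ℕ} (f : Euc n → ℝ) : ℝ := sInf (f '' uSphere n)

/-- The function `f^(-1/q)`. -/
def negPowExt {n : ℕ} (f : Euc n → ℝ) (q : ℝ) : Euc n → ℝ := fun y => f y ^ (-(1 / q))

/-- Assumption 1.3 of the paper (Assumption (A)): the gradient-and-Hessian conditions on the
prescribed function `f`, according to the value of `p`. -/
def AssumptionA (n k : ℕ) (p : ℝ) (f : Euc n → ℝ) : Prop :=
  ((p = 0) →
    ∀ x ∈ uSphere n, ∀ v : Euc n, ⟪x, v⟫ = 0 →
      0 ≤ hessS (negPowExt f (k : ℝ)) x v v - ‖gradS (negPowExt f (k : ℝ)) x‖ * ‖v‖ ^ 2 +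
          negPowExt f (k : ℝ) x /
              (2 + 8 * sphSup fun y => (f y / (n.choose k : ℝ)) ^ (1 / (k : ℝ))) * ‖v‖ ^ 2) ∧
  ((0 < p ∧ p ≤ (k : ℝ) / 2) →
    ∀ x ∈ uSphere n, ∀ v : Euc n, ⟪x, v⟫ = 0 →
      0 ≤ hessS (negPowExt f (k : ℝ)) x v v -
            (((k : ℝ) + 2 * p) / (k : ℝ)) * ‖gradS (negPowExt f (k : ℝ)) x‖ * ‖v‖ ^ 2 +
          (p ^ 2 / (k : ℝ) ^ 2) * negPowExt f (k : ℝ) x * ‖v‖ ^ 2) ∧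
  (((k : ℝ) / 2 < p ∧ p < (k : ℝ)) →
    ∀ x ∈ uSphere n, ∀ v : Euc n, ⟪x, v⟫ = 0 →
      0 ≤ hessS (negPowExt f (k : ℝ)) x v v -
            ((3 * (k : ℝ) - 2 * p) ^ 2 / (p * (2 * p - (k : ℝ)))) *
              (‖gradS (negPowExt f (k : ℝ)) x‖ ^ 2 / (2 * negPowExt f (k : ℝ) x)) * ‖v‖ ^ 2 +
          (p / (2 * (k : ℝ))) * negPowExt f (k : ℝ) x * ‖v‖ ^ 2) ∧
  (((k : ℝ) ≤ p ∧ p < 2 * (k : ℝ)) →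
    ∀ x ∈ uSphere n, ∀ v : Euc n, ⟪x, v⟫ = 0 →
      0 ≤ hessS (negPowExt f p) x v v -
            (‖gradS (negPowExt f p) x‖ ^ 2 / (2 * negPowExt f p x)) * ‖v‖ ^ 2 +
          (1 / 2) * negPowExt f p x * ‖v‖ ^ 2) ∧
  ((p = 2 * (k : ℝ)) →
    sphSup f < (n.choose k : ℝ) / 2 ^ k ∧
    ∀ x ∈ uSphere n, ∀ v : Euc n, ⟪x, v⟫ = 0 →
      0 ≤ hessS (negPowExt f p) x v v -
            (‖gradS (negPowExt f p) x‖ ^ 2 / (2 * negPowExt f p x)) * ‖v‖ ^ 2 +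
          (1 / 2) * negPowExt f p x * ‖v‖ ^ 2) ∧
  ((2 * (k : ℝ) < p) →
    2 ≤ k ∧
    sphInf f ≤
      (k : ℝ) ^ k * (p - 2 * (k : ℝ)) ^ ((p - 2 * (k : ℝ)) / 2) / p ^ (p / 2) * (n.choose k : ℝ) ∧
    ∀ x ∈ uSphere n, ∀ v : Euc n, ⟪x, v⟫ = 0 →
      0 ≤ hessS (negPowExt f p) x v v -
            (‖gradS (negPowExt f p) x‖ ^ 2 / (2 * negPowExt f p x)) * ‖v‖ ^ 2 +
          ((k : ℝ) / p) * negPowExt f p x * ‖v‖ ^ 2)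

/-- The elementary symmetric function of degree `k` of the numbers `l i`, `i ∈ s`. -/
def esum {ι : Type*} (l : ι → ℝ) (k : ℕ) (s : Finset ι) : ℝ :=
  ∑ t ∈ powersetCard k s, ∏ i ∈ t, l i

section Esum

variable {ι : Type*} {l : ι → ℝ}

lemma esum_zero (s : Finset ι) : esum l 0 s = 1 := by simp [esum]

lemma esum_empty_succ (k : ℕ) : esum l (k + 1) ∅ = 0 := by
  rw [esum, powersetCard_eq_empty.2 (by simp), sum_empty]

lemma esum_one (s : Finset ι) : esum l 1 s = ∑ i ∈ s, l i := by
  simp [esum, powersetCard_one]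

lemma esum_const (a : ℝ) (k : ℕ) (s : Finset ι) :
    esum (fun _ => a) k s = (s.card.choose k : ℝ) * a ^ k := by
  rw [esum, sum_congr rfl (g := fun _ => a ^ k), sum_const, card_powersetCard, nsmul_eq_mul]
  intro t ht
  rw [prod_const, (mem_powersetCard.1 ht).2]

lemma esum_nonneg {s : Finset ι} (h : ∀ i ∈ s, 0 ≤ l i) (k : ℕ) : 0 ≤ esum l k s :=
  sum_nonneg fun _ ht => prod_nonneg fun i hi => h i ((mem_powersetCard.1 ht).1 hi)

lemma pow_le_esum {s : Finset ι} {a : ℝ} (ha : 0 ≤ a) (h : ∀ i ∈ s, a ≤ l i) {k : ℕ}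
    (hk : k ≤ s.card) : a ^ k ≤ esum l k s := by
  obtain ⟨t, ht⟩ := powersetCard_nonempty.2 hk
  have hmem := mem_powersetCard.1 ht
  calc a ^ k = ∏ i ∈ t, a := by rw [prod_const, hmem.2]
    _ ≤ ∏ i ∈ t, l i := prod_le_prod (fun _ _ => ha) fun i hi => h i (hmem.1 hi)
    _ ≤ esum l k s := single_le_sum (f := fun t => ∏ i ∈ t, l i)
        (fun u hu => prod_nonneg fun i hi => ha.trans (h i ((mem_powersetCard.1 hu).1 hi))) ht

lemma esum_le {s : Finset ι} {b : ℝ} (h0 : ∀ i ∈ s, 0 ≤ l i) (h : ∀ i ∈ s, l i ≤ b) (k : ℕ) :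
    esum l k s ≤ (s.card.choose k : ℝ) * b ^ k := by
  rw [← esum_const]
  exact sum_le_sum fun t ht => prod_le_prod (fun i hi => h0 i ((mem_powersetCard.1 ht).1 hi))
    fun i hi => h i ((mem_powersetCard.1 ht).1 hi)

lemma esum_eq_zero {s : Finset ι} {k : ℕ} (h : s.card < k) : esum l k s = 0 := by
  rw [esum, powersetCard_eq_empty.2 h, sum_empty]

lemma esum_pos {s : Finset ι} (h : ∀ i ∈ s, 0 < l i) {k : ℕ} (hk : k ≤ s.card) :
    0 < esum l k s :=
  sum_pos (fun _ hu => prod_pos fun i hi => h i ((mem_powersetCard.1 hu).1 hi))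
    (powersetCard_nonempty.2 hk)

lemma newton_step {K m x t r q w : ℝ} (hK : 1 ≤ K) (hm : 0 ≤ m) (hq : 0 < q) (hr : 0 < r)
    (_ht : 0 ≤ t) (hw : 0 ≤ w) (h1 : (K + 1) * (m + 1) * (t * q) ≤ K * m * r ^ 2)
    (h2 : K * (m + 2) * (r * w) ≤ (K - 1) * (m + 1) * q ^ 2) (hx : 0 ≤ x) :
    (K + 1) * (m + 2) * ((t + x * r) * (q + x * w)) ≤ K * (m + 1) * (r + x * q) ^ 2 := by
  have h3 : (K + 1) * (m + 2) * (t * w) ≤ (K - 1) * m * (r * q) := by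
    have := mul_le_mul h1 h2 (by positivity) (by positivity)
    refine le_of_mul_le_mul_left (a := K * (m + 1) * (q * r)) ?_ (by positivity)
    linear_combination this
  refine le_of_mul_le_mul_left (a := K * (m + 1)) ?_ (by positivity)
  have e1 := mul_le_mul_of_nonneg_left h1 (by positivity : 0 ≤ K * (m + 2))
  have e2 := mul_le_mul_of_nonneg_left h2 (by positivity : 0 ≤ (K + 1) * (m + 1) * x ^ 2)
  have e3 := mul_le_mul_of_nonneg_left h3 (by positivity : 0 ≤ K * (m + 1) * x)
  linear_combination e1 + e2 + e3 + sq_nonneg (K * r - (m + 1) * x * q)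

/-- The elementary symmetric mean of degree `k`. -/
def emean (l : ι → ℝ) (k : ℕ) (s : Finset ι) : ℝ := esum l k s / (s.card.choose k : ℝ)

lemma emean_pos {s : Finset ι} (h : ∀ i ∈ s, 0 < l i) {k : ℕ} (hk : k ≤ s.card) :
    0 < emean l k s :=
  div_pos (esum_pos h hk) (by exact_mod_cast Nat.choose_pos hk)

lemma sum_sum_sub_mul_sub (s : Finset ι) (a b : ι → ℝ) :
    ∑ i ∈ s, ∑ j ∈ s, (a i - a j) * (b i - b j)
      = 2 * (s.card * ∑ i ∈ s, a i * b i - (∑ i ∈ s, a i) * ∑ i ∈ s, b i) := by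
  have : ∀ i ∈ s, ∑ j ∈ s, (a i - a j) * (b i - b j) = s.card * (a i * b i)
      - a i * ∑ j ∈ s, b j - b i * ∑ j ∈ s, a j + ∑ j ∈ s, a j * b j := by
    intro i _
    rw [mul_sum, mul_sum, ← nsmul_eq_mul, ← sum_const, ← sum_sub_distrib, ← sum_sub_distrib,
      ← sum_add_distrib]
    exact sum_congr rfl fun j _ => by ring
  rw [sum_congr rfl this, sum_add_distrib, sum_sub_distrib, sum_sub_distrib, sum_const,
    ← mul_sum, ← sum_mul, ← sum_mul, nsmul_eq_mul]
  ring

variable [DecidableEq ι]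

lemma esum_succ_insert {s : Finset ι} {a : ι} (ha : a ∉ s) (k : ℕ) :
    esum l (k + 1) (insert a s) = esum l (k + 1) s + l a * esum l k s := by
  rw [esum, powersetCard_succ_insert ha, sum_union, esum, esum, mul_sum]
  · congr 1
    rw [sum_image]
    · refine sum_congr rfl fun t ht => ?_
      rw [prod_insert fun h => ha ((mem_powersetCard.1 ht).1 h)]
    · intro t ht u hu htu
      have h1 : a ∉ t := fun h => ha ((mem_powersetCard.1 ht).1 h)
      have h2 : a ∉ u := fun h => ha ((mem_powersetCard.1 hu).1 h)
      rw [← erase_insert h1, ← erase_insert h2]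
      exact congrArg (fun w => w.erase a) htu
  · rw [disjoint_left]
    rintro t ht htt
    obtain ⟨u, -, rfl⟩ := mem_image.1 htt
    exact ha ((mem_powersetCard.1 ht).1 (mem_insert_self a u))

lemma esum_succ_of_mem {s : Finset ι} {a : ι} (ha : a ∈ s) (k : ℕ) :
    esum l (k + 1) s = esum l (k + 1) (s.erase a) + l a * esum l k (s.erase a) := by
  conv_lhs => rw [← insert_erase ha]
  exact esum_succ_insert (notMem_erase a s) k

lemma sum_mul_esum_erase (s : Finset ι) (k : ℕ) :
    ∑ i ∈ s, l i * esum l k (s.erase i) = (k + 1) * esum l (k + 1) s := by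
  induction s using Finset.induction_on generalizing k with
  | empty => simp [esum_empty_succ]
  | insert a s ha ih =>
    rw [sum_insert ha, erase_insert ha, esum_succ_insert ha]
    have e : ∀ i ∈ s, (insert a s).erase i = insert a (s.erase i) := fun i hi =>
      erase_insert_of_ne fun h => ha (h ▸ hi)
    cases k with
    | zero =>
      have := ih 0
      rw [sum_congr rfl (g := fun i => l i * esum l 0 (s.erase i)), this]
      · simp [esum_zero]; ring
      · intro i _; simp [esum_zero]
    | succ k =>
      rw [sum_congr rfl (g := fun i => l i * esum l (k + 1) (s.erase i)
        + l a * (l i * esum l k (s.erase i))), sum_add_distrib, ← mul_sum, ih, ih]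
      · push_cast; ring
      · intro i hi
        rw [e i hi, esum_succ_insert (fun h => ha (mem_of_mem_erase h))]; ring

lemma sum_esum_erase (s : Finset ι) (k : ℕ) :
    ∑ i ∈ s, esum l k (s.erase i) = ((s.card : ℝ) - k) * esum l k s := by
  cases k with
  | zero => simp [esum_zero]
  | succ k =>
    have h : ∀ i ∈ s, esum l (k + 1) (s.erase i)
        = esum l (k + 1) s - l i * esum l k (s.erase i) := fun i hi => by
      rw [esum_succ_of_mem hi]; ring
    rw [sum_congr rfl h, sum_sub_distrib, sum_mul_esum_erase]
    simp; ring

/-- Newton's inequality. -/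
lemma newton_esum (s : Finset ι) (h : ∀ i ∈ s, 0 < l i) (k : ℕ) :
    ((k : ℝ) + 2) * (s.card - k) * (esum l (k + 2) s * esum l k s)
      ≤ ((k : ℝ) + 1) * (s.card - k - 1) * esum l (k + 1) s ^ 2 := by
  induction s using Finset.induction_on generalizing k with
  | empty =>
    rw [esum_empty_succ, esum_empty_succ]; simp
  | insert a s ha ih =>
    have hs : ∀ i ∈ s, 0 < l i := fun i hi => h i (mem_insert_of_mem hi)
    have ih := ih hs
    have nn : ∀ m, 0 ≤ esum l m s := esum_nonneg fun i hi => (hs i hi).le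
    rw [card_insert_of_notMem ha, esum_succ_insert ha, esum_succ_insert ha]
    rcases lt_or_ge s.card (k + 1) with hc | hc
    · rw [esum_eq_zero hc, esum_eq_zero (k := k + 2) (by omega)]
      rcases lt_or_ge s.card k with hc' | hc'
      · rw [esum_eq_zero hc']; simp
      · have : (s.card : ℝ) = k := by exact_mod_cast (by omega : s.card = k)
        push_cast
        rw [this]; ring_nf; rfl
    · obtain ⟨m, hm⟩ : ∃ m : ℕ, s.card = k + 1 + m := ⟨s.card - (k + 1), by omega⟩
      have hmr : (s.card : ℝ) = k + 1 + m := by exact_mod_cast hm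
      have key : ∀ w : ℝ, 0 ≤ w → ((k : ℝ) + 1) * (m + 2) * (esum l (k + 1) s * w)
          ≤ k * (m + 1) * esum l k s ^ 2 → ((k : ℝ) + 2) * (m + 2) *
          ((esum l (k + 2) s + l a * esum l (k + 1) s) * (esum l k s + l a * w))
          ≤ (k + 1) * (m + 1) * (esum l (k + 1) s + l a * esum l k s) ^ 2 := by
        intro w hw h2
        have h1 := ih k
        rw [hmr] at h1
        have := newton_step (K := k + 1) (m := m) (by linarith [k.cast_nonneg (α := ℝ)])
          m.cast_nonneg (esum_pos hs (by omega)) (esum_pos hs hc) (nn (k + 2)) hw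
          (x := l a) (t := esum l (k + 2) s) (r := esum l (k + 1) s) (q := esum l k s) (w := w)
          (by linear_combination h1) (by linear_combination h2) (h a (mem_insert_self a s)).le
        linear_combination this
      push_cast
      rw [hmr]
      cases k with
      | zero =>
        have := key 0 le_rfl (by simp)
        simp only [esum_zero] at this ⊢
        linear_combination this
      | succ j =>
        rw [esum_succ_insert ha]
        have h2 := ih j
        rw [hmr] at h2
        push_cast at h2
        have := key _ (nn j) (by push_cast; linear_combination h2)
        push_cast at this ⊢
        linear_combination this

lemma emean_newton {s : Finset ι} (h : ∀ i ∈ s, 0 < l i) {k : ℕ} (hk : k + 2 ≤ s.card) :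
    emean l (k + 2) s * emean l k s ≤ emean l (k + 1) s ^ 2 := by
  have hN := newton_esum s h k
  obtain ⟨m, hm⟩ : ∃ m : ℕ, s.card = k + 2 + m := ⟨s.card - (k + 2), by omega⟩
  have hmr : (s.card : ℝ) = k + 2 + m := by exact_mod_cast hm
  have p0 : (0 : ℝ) < s.card.choose k := by exact_mod_cast Nat.choose_pos (by omega)
  have p1 : (0 : ℝ) < s.card.choose (k + 1) := by exact_mod_cast Nat.choose_pos (by omega)
  have p2 : (0 : ℝ) < s.card.choose (k + 2) := by exact_mod_cast Nat.choose_pos (by omega)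
  have e1 : (s.card.choose (k + 1) : ℝ) * (k + 1) = s.card.choose k * (m + 2) := by
    have := Nat.choose_succ_right_eq s.card k
    rw [show s.card - k = m + 2 by omega] at this
    exact_mod_cast this
  have e2 : (s.card.choose (k + 2) : ℝ) * (k + 2) = s.card.choose (k + 1) * (m + 1) := by
    have := Nat.choose_succ_right_eq s.card (k + 1)
    rw [show s.card - (k + 1) = m + 1 by omega] at this
    exact_mod_cast this
  have e0 : esum l (k + 2) s = emean l (k + 2) s * s.card.choose (k + 2) := by
    rw [emean, div_mul_cancel₀ _ p2.ne']
  have e0' : esum l (k + 1) s = emean l (k + 1) s * s.card.choose (k + 1) := by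
    rw [emean, div_mul_cancel₀ _ p1.ne']
  have e0'' : esum l k s = emean l k s * s.card.choose k := by
    rw [emean, div_mul_cancel₀ _ p0.ne']
  rw [e0, e0', e0'', hmr] at hN
  set X := emean l (k + 2) s
  set Y := emean l (k + 1) s
  set Z := emean l k s
  set c0 : ℝ := (s.card.choose k : ℝ)
  set c1 : ℝ := (s.card.choose (k + 1) : ℝ)
  set c2 : ℝ := (s.card.choose (k + 2) : ℝ)
  have hpos : (0 : ℝ) < (k + 1) * (m + 1) * c1 ^ 2 := by positivity
  refine le_of_mul_le_mul_left (a := (k + 1) * (m + 1) * c1 ^ 2) ?_ hpos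
  have : ((k : ℝ) + 1) * (m + 1) * c1 ^ 2 = (k + 2) * (m + 2) * (c2 * c0) := by
    linear_combination (m + 1) * c1 * e1 - c0 * (m + 2) * e2
  calc _ = ((k : ℝ) + 2) * (m + 2) * (c2 * c0) * (X * Z) := by rw [this]
    _ ≤ _ := by linear_combination hN

/-- Maclaurin's inequality for consecutive elementary symmetric means. -/
lemma emean_maclaurin {s : Finset ι} (h : ∀ i ∈ s, 0 < l i) {k : ℕ} (hk : k + 1 ≤ s.card) :
    emean l (k + 1) s ^ k ≤ emean l k s ^ (k + 1) := by
  induction k with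
  | zero => simp [emean, esum_zero]
  | succ k ih =>
    have h0 := emean_pos h (by omega : k ≤ s.card)
    have h1 := emean_pos h (by omega : k + 1 ≤ s.card)
    have h2 := emean_pos h hk
    have hN := pow_le_pow_left₀ (by positivity) (emean_newton h hk) (k + 1)
    have ih := ih (by omega)
    set X := emean l (k + 2) s
    set Y := emean l (k + 1) s
    set Z := emean l k s
    refine le_of_mul_le_mul_right (a := Y ^ k) ?_ (by positivity)
    calc X ^ (k + 1) * Y ^ k ≤ X ^ (k + 1) * Z ^ (k + 1) := by gcongr
      _ = (X * Z) ^ (k + 1) := by rw [mul_pow]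
      _ ≤ (Y ^ 2) ^ (k + 1) := hN
      _ = Y ^ (k + 2) * Y ^ k := by ring

lemma emean_le_pow {s : Finset ι} (h : ∀ i ∈ s, 0 < l i) {k : ℕ} (hk : k + 1 ≤ s.card) :
    emean l (k + 1) s ≤ emean l 1 s ^ (k + 1) := by
  induction k with
  | zero => simp
  | succ k ih =>
    have h1 := emean_pos h (by omega : k + 1 ≤ s.card)
    have hp := emean_pos h (by omega : 1 ≤ s.card)
    refine le_of_pow_le_pow_left₀ (n := k + 1) (by omega) (by positivity) ?_
    calc emean l (k + 2) s ^ (k + 1) ≤ emean l (k + 1) s ^ (k + 2) := emean_maclaurin h hk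
      _ ≤ (emean l 1 s ^ (k + 1)) ^ (k + 2) := pow_le_pow_left₀ h1.le (ih (by omega)) _
      _ = _ := by ring

lemma mul_esum_erase_sub {s : Finset ι} {i j : ι} (hi : i ∈ s) (hj : j ∈ s) (hij : i ≠ j)
    (m : ℕ) : l i * esum l m (s.erase i) - l j * esum l m (s.erase j)
      = (l i - l j) * esum l m ((s.erase i).erase j) := by
  have hc : (s.erase j).erase i = (s.erase i).erase j := erase_right_comm
  cases m with
  | zero => simp [esum_zero]
  | succ m =>
    rw [esum_succ_of_mem (mem_erase.2 ⟨hij.symm, hj⟩ : j ∈ s.erase i),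
      esum_succ_of_mem (mem_erase.2 ⟨hij, hi⟩ : i ∈ s.erase j), hc]
    ring

lemma esum_chebyshev {s : Finset ι} {a : ℝ} (ha : 0 < a) (h : ∀ i ∈ s, a ≤ l i) {m : ℕ}
    (hm : m + 2 ≤ s.card) :
    a ^ m * (s.card * ∑ i ∈ s, l i ^ 2 - (∑ i ∈ s, l i) ^ 2)
      ≤ s.card * ∑ i ∈ s, esum l m (s.erase i) * l i ^ 2
        - (∑ i ∈ s, l i) * ((m + 1) * esum l (m + 1) s) := by
  have h1 := sum_sum_sub_mul_sub s l l
  have h2 := sum_sum_sub_mul_sub s l fun i => l i * esum l m (s.erase i)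
  have key : a ^ m * ∑ i ∈ s, ∑ j ∈ s, (l i - l j) * (l i - l j) ≤ ∑ i ∈ s, ∑ j ∈ s,
      (l i - l j) * (l i * esum l m (s.erase i) - l j * esum l m (s.erase j)) := by
    rw [mul_sum]
    refine sum_le_sum fun i hi => ?_
    rw [mul_sum]
    refine sum_le_sum fun j hj => ?_
    rcases eq_or_ne i j with rfl | hij
    · simp
    · rw [mul_esum_erase_sub hi hj hij]
      have : a ^ m ≤ esum l m ((s.erase i).erase j) :=
        pow_le_esum ha.le (fun t ht => h t (mem_of_mem_erase (mem_of_mem_erase ht))) (by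
          rw [card_erase_of_mem (mem_erase.2 ⟨hij.symm, hj⟩), card_erase_of_mem hi]; omega)
      nlinarith [mul_le_mul_of_nonneg_left this (mul_self_nonneg (l i - l j))]
  rw [sum_mul_esum_erase] at h2
  have e1 : ∑ i ∈ s, l i * l i = ∑ i ∈ s, l i ^ 2 := sum_congr rfl fun i _ => by ring
  have e2 : ∑ i ∈ s, l i * (l i * esum l m (s.erase i))
      = ∑ i ∈ s, esum l m (s.erase i) * l i ^ 2 := sum_congr rfl fun i _ => by ring
  rw [e1] at h1
  rw [e2] at h2
  rw [h1, h2] at key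
  linarith

lemma le_sum_mul_esum_erase_sub {s : Finset ι} {a : ℝ} (ha : 0 < a) (h : ∀ i ∈ s, a ≤ l i) {m : ℕ}
    (hm : m + 2 ≤ s.card) {i : ι} (hi : i ∈ s) :
    a ^ (m + 1) ≤ (m + 1) * esum l (m + 1) s - l i * esum l m (s.erase i) := by
  have hS : ∀ j ∈ s, a ^ m ≤ esum l m (s.erase j) := fun j hj =>
    pow_le_esum ha.le (fun t ht => h t (mem_of_mem_erase ht)) (by
      rw [card_erase_of_mem hj]; omega)
  rw [← sum_mul_esum_erase, ← add_sum_erase s _ hi]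
  obtain ⟨j, hj⟩ : (s.erase i).Nonempty := card_pos.1 (by rw [card_erase_of_mem hi]; omega)
  have hpos : ∀ t ∈ s, a ^ (m + 1) ≤ l t * esum l m (s.erase t) := fun t ht => by
    rw [pow_succ']
    exact mul_le_mul (h t ht) (hS t ht) (by positivity) (ha.le.trans (h t ht))
  have := single_le_sum (f := fun t => l t * esum l m (s.erase t)) (s := s.erase i)
    (fun t ht => (pow_pos ha (m + 1)).le.trans (hpos t (mem_of_mem_erase ht))) hj
  linarith [hpos j (mem_of_mem_erase hj)]

lemma le_emean_one_of_esum_eq {s : Finset ι} (h : ∀ i ∈ s, 0 < l i) {m : ℕ} {f : ℝ}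
    (hm : m + 1 ≤ s.card) (hF : esum l (m + 1) s = (s.card.choose (m + 1) : ℝ) * f ^ (m + 1)) :
    f * s.card ≤ ∑ i ∈ s, l i := by
  have p1 : (0 : ℝ) < s.card.choose (m + 1) := by exact_mod_cast Nat.choose_pos hm
  have hs : (0 : ℝ) < s.card := by exact_mod_cast (by omega : 0 < s.card)
  have hE := emean_le_pow h hm
  rw [emean, hF, mul_div_cancel_left₀ _ p1.ne'] at hE
  have := le_of_pow_le_pow_left₀ (by omega) (emean_pos h (by omega)).le hE
  rwa [emean, esum_one, Nat.choose_one_right, le_div_iff₀ hs] at this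

lemma le_mul_sum_esum_erase {s : Finset ι} (h : ∀ i ∈ s, 0 < l i) {m : ℕ} {f : ℝ} (hf : 0 < f)
    (hm : m + 1 ≤ s.card) (hF : esum l (m + 1) s = (s.card.choose (m + 1) : ℝ) * f ^ (m + 1)) :
    (m + 1) * esum l (m + 1) s ≤ f * ∑ i ∈ s, esum l m (s.erase i) := by
  have p0 : (0 : ℝ) < s.card.choose m := by exact_mod_cast Nat.choose_pos (by omega)
  have p1 : (0 : ℝ) < s.card.choose (m + 1) := by exact_mod_cast Nat.choose_pos hm
  have hE := emean_maclaurin h hm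
  have h0 := emean_pos h (by omega : m ≤ s.card)
  rw [emean, hF, mul_div_cancel_left₀ _ p1.ne', ← pow_mul, mul_comm (m + 1), pow_mul] at hE
  have := le_of_pow_le_pow_left₀ (by omega) h0.le hE
  rw [emean, le_div_iff₀ p0] at this
  have e1 : (s.card.choose (m + 1) : ℝ) * (m + 1) = s.card.choose m * (s.card - m) := by
    have := Nat.choose_succ_right_eq s.card m
    rw [← Nat.cast_sub (by omega : m ≤ s.card)]
    exact_mod_cast this
  have hc : (0 : ℝ) ≤ s.card - m := by
    have : ((m + 1 : ℕ) : ℝ) ≤ s.card := by exact_mod_cast hm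
    push_cast at this; linarith
  rw [sum_esum_erase, hF]
  linear_combination f * (s.card - m) * this + f ^ (m + 1) * e1

end Esum

section Sigma

lemma sigmaMat_of_diagonal {N : ℕ} {M : Matrix (Fin N) (Fin N) ℝ} {l : Fin N → ℝ}
    (h : ∀ i j, M i j = if i = j then l i else 0) (k : ℕ) : sigmaMat k M = esum l k univ := by
  refine sum_congr rfl fun s _ => ?_
  have : (Matrix.of fun i j : {a : Fin N // a ∈ s} => M i.1 j.1)
      = Matrix.diagonal fun i : {a : Fin N // a ∈ s} => l i := by
    ext i j
    rw [Matrix.of_apply, h, Matrix.diagonal_apply]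
    simp only [Subtype.ext_iff]
  rw [this, Matrix.det_diagonal]
  exact prod_coe_sort s l

lemma hasDerivAt_det_of_diagonal {ι : Type*} [Fintype ι] [DecidableEq ι] {M : ℝ → Matrix ι ι ℝ}
    {M' : Matrix ι ι ℝ} {l : ι → ℝ} {t₀ : ℝ}
    (hM : ∀ i j, HasDerivAt (fun t => M t i j) (M' i j) t₀)
    (h : ∀ i j, M t₀ i j = if i = j then l i else 0) :
    HasDerivAt (fun t => (M t).det) (∑ i, (∏ j ∈ univ.erase i, l j) * M' i i) t₀ := by
  have h1 : HasDerivAt (fun t => (M t).det) (∑ σ : Equiv.Perm ι, (Equiv.Perm.sign σ : ℤ) •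
      ∑ i, (∏ j ∈ univ.erase i, M t₀ (σ j) j) • M' (σ i) i) t₀ := by
    simp only [Matrix.det_apply, Units.smul_def]
    refine HasDerivAt.fun_sum fun σ _ => ?_
    have := HasDerivAt.fun_finsetProd (u := univ) fun i _ => hM (σ i) i
    simpa only [zsmul_eq_mul] using this.const_mul (((Equiv.Perm.sign σ : ℤ)) : ℝ)
  convert h1 using 1
  rw [Fintype.sum_eq_single (1 : Equiv.Perm ι)]
  · simp [h]
  · intro σ hσ
    obtain ⟨i, hi⟩ : ∃ i, σ i ≠ i := by
      by_contra! hc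
      exact hσ (Equiv.ext hc)
    have hz : ∀ a, ∏ j ∈ univ.erase a, M t₀ (σ j) j = 0 := by
      intro a
      rcases eq_or_ne i a with rfl | hia
      · exact prod_eq_zero (mem_erase.2 ⟨hi, mem_univ (σ i)⟩)
          (by rw [h, if_neg fun e => hi (σ.injective e)])
      · exact prod_eq_zero (mem_erase.2 ⟨hia, mem_univ i⟩) (by rw [h, if_neg hi])
    simp [hz]

lemma sum_powersetCard_succ_sum {ι : Type*} [DecidableEq ι] (u : Finset ι) (m : ℕ)
    (g : Finset ι → ι → ℝ) : ∑ s ∈ powersetCard (m + 1) u, ∑ i ∈ s, g (s.erase i) i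
      = ∑ i ∈ u, ∑ t ∈ powersetCard m (u.erase i), g t i := by
  rw [sum_sigma', sum_sigma']
  refine sum_bij' (fun p _ => ⟨p.2, p.1.erase p.2⟩) (fun p _ => ⟨insert p.1 p.2, p.1⟩)
    ?_ ?_ ?_ ?_ ?_
  · rintro ⟨s, i⟩ h
    simp only [mem_sigma, mem_powersetCard] at h ⊢
    exact ⟨h.1.1 h.2, erase_subset_erase _ h.1.1, by rw [card_erase_of_mem h.2, h.1.2]; rfl⟩
  · rintro ⟨i, t⟩ h
    simp only [mem_sigma, mem_powersetCard] at h ⊢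
    have hi : i ∉ t := fun hit => notMem_erase i u (h.2.1 hit)
    exact ⟨⟨insert_subset h.1 (h.2.1.trans (erase_subset _ _)),
      by rw [card_insert_of_notMem hi, h.2.2]⟩, mem_insert_self _ _⟩
  · rintro ⟨s, i⟩ h
    simp only [mem_sigma] at h
    simp [insert_erase h.2]
  · rintro ⟨i, t⟩ h
    simp only [mem_sigma, mem_powersetCard] at h
    have hi : i ∉ t := fun hit => notMem_erase i u (h.2.1 hit)
    simp [erase_insert hi]
  · rintro ⟨s, i⟩ _
    rfl

lemma hasDerivAt_sigmaMat_of_diagonal {N : ℕ} {M : ℝ → Matrix (Fin N) (Fin N) ℝ}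
    {M' : Matrix (Fin N) (Fin N) ℝ} {l : Fin N → ℝ} {t₀ : ℝ}
    (hM : ∀ i j, HasDerivAt (fun t => M t i j) (M' i j) t₀)
    (h : ∀ i j, M t₀ i j = if i = j then l i else 0) (m : ℕ) :
    HasDerivAt (fun t => sigmaMat (m + 1) (M t))
      (∑ i, esum l m (univ.erase i) * M' i i) t₀ := by
  have h1 : HasDerivAt (fun t => sigmaMat (m + 1) (M t))
      (∑ s ∈ powersetCard (m + 1) (univ : Finset (Fin N)), ∑ i ∈ s,
        (∏ j ∈ s.erase i, l j) * M' i i) t₀ := by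
    refine HasDerivAt.fun_sum fun s _ => ?_
    have := hasDerivAt_det_of_diagonal (t₀ := t₀) (l := fun i : {a : Fin N // a ∈ s} => l i)
      (M := fun t => Matrix.of fun i j : {a : Fin N // a ∈ s} => M t i.1 j.1)
      (M' := Matrix.of fun i j : {a : Fin N // a ∈ s} => M' i.1 j.1)
      (fun i j => hM i j) (fun i j => by rw [Matrix.of_apply, h]; simp only [Subtype.ext_iff])
    refine this.congr_deriv ?_
    rw [← sum_coe_sort s fun i => (∏ j ∈ s.erase i, l j) * M' i i]
    refine sum_congr rfl fun i _ => ?_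
    congr 1
    refine prod_bij (fun a _ => a.1) ?_ ?_ ?_ ?_
    · intro a ha
      exact mem_erase.2 ⟨fun e => (mem_erase.1 ha).1 (Subtype.ext e), a.2⟩
    · intro a _ b _ e
      exact Subtype.ext e
    · intro b hb
      exact ⟨⟨b, mem_of_mem_erase hb⟩,
        mem_erase.2 ⟨fun e => (mem_erase.1 hb).1 (congrArg Subtype.val e), mem_univ _⟩, rfl⟩
    · intro a _
      rfl
  convert h1 using 1
  rw [sum_powersetCard_succ_sum univ m fun t i => (∏ j ∈ t, l j) * M' i i]
  exact sum_congr rfl fun i _ => by rw [esum, sum_mul]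

end Sigma

/-- The second derivative of a function on Euclidean space. -/
def secondDeriv {n : ℕ} (φ : Euc n → ℝ) (y : Euc n) : Euc n →L[ℝ] Euc n →L[ℝ] ℝ :=
  fderiv ℝ (fderiv ℝ φ) y

/-- The third derivative of a function on Euclidean space. -/
def thirdDeriv {n : ℕ} (φ : Euc n → ℝ) (y u v w : Euc n) : ℝ :=
  fderiv ℝ (secondDeriv φ) y u v w

/-- The coefficient of the metric in `A[φ]`. -/
def metricCoeff {n : ℕ} (φ : Euc n → ℝ) (y : Euc n) : ℝ :=
  (φ y - (φ y)⁻¹) / 2 - ‖gradient φ y‖ ^ 2 / (2 * φ y)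

/-- The great circle through `x` with initial velocity `e`. -/
def greatCircle {n : ℕ} (x e : Euc n) (t : ℝ) : Euc n := Real.cos t • x + Real.sin t • e

section GreatCircle

variable {n : ℕ} {x e : Euc n}

lemma greatCircle_zero : greatCircle x e 0 = x := by simp [greatCircle]

lemma greatCircle_pi : greatCircle x e Real.pi = -x := by simp [greatCircle]

lemma hasDerivAt_greatCircle (t : ℝ) :
    HasDerivAt (greatCircle x e) (greatCircle e (-x) t) t := by
  have h := ((Real.hasDerivAt_cos t).smul_const x).add ((Real.hasDerivAt_sin t).smul_const e)
  refine h.congr_deriv ?_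
  simp only [greatCircle]
  module

lemma neg_neg_greatCircle (t : ℝ) : greatCircle (-x) (-e) t = -greatCircle x e t := by
  simp only [greatCircle]; module

lemma inner_greatCircle (hx : ‖x‖ = 1) (he : ‖e‖ = 1) (hxe : ⟪x, e⟫ = 0) (t : ℝ) :
    ‖greatCircle x e t‖ = 1 ∧ ‖greatCircle e (-x) t‖ = 1 ∧
      ⟪greatCircle x e t, greatCircle e (-x) t⟫ = 0 := by
  have hex : ⟪e, x⟫ = 0 := by rw [real_inner_comm, hxe]
  have hxx : ⟪x, x⟫ = 1 := by rw [real_inner_self_eq_norm_sq, hx]; norm_num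
  have hee : ⟪e, e⟫ = 1 := by rw [real_inner_self_eq_norm_sq, he]; norm_num
  have h := Real.sin_sq_add_cos_sq t
  refine ⟨?_, ?_, ?_⟩
  · rw [← sq_eq_sq₀ (norm_nonneg _) zero_le_one, ← real_inner_self_eq_norm_sq]
    simp only [greatCircle, inner_add_left, inner_add_right, real_inner_smul_left,
      real_inner_smul_right, hxe, hex, hxx, hee]
    linarith
  · rw [← sq_eq_sq₀ (norm_nonneg _) zero_le_one, ← real_inner_self_eq_norm_sq]
    simp only [greatCircle, inner_add_left, inner_add_right, real_inner_smul_left,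
      real_inner_smul_right, inner_neg_left, inner_neg_right, hxe, hex, hxx, hee]
    linarith
  · simp only [greatCircle, inner_add_left, inner_add_right, real_inner_smul_left,
      real_inner_smul_right, inner_neg_right, hxe, hex, hxx, hee]
    ring

end GreatCircle

section Calculus

variable {n : ℕ} {φ : Euc n → ℝ}

lemma ne_zero_of_norm_eq_one {x : Euc n} (hx : ‖x‖ = 1) : x ≠ 0 := by
  rintro rfl; simp at hx

lemma isOpen_ne_zero : IsOpen {y : Euc n | y ≠ 0} := isOpen_ne

lemma SmoothFn.contDiffOn_fderiv (hs : SmoothFn φ) :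
    ContDiffOn ℝ (⊤ : ℕ∞) (fderiv ℝ φ) {y : Euc n | y ≠ 0} :=
  hs.fderiv_of_isOpen isOpen_ne_zero (by simp)

lemma SmoothFn.contDiffOn_secondDeriv (hs : SmoothFn φ) :
    ContDiffOn ℝ (⊤ : ℕ∞) (secondDeriv φ) {y : Euc n | y ≠ 0} :=
  hs.contDiffOn_fderiv.fderiv_of_isOpen isOpen_ne_zero (by simp)

lemma SmoothFn.contDiffAt (hs : SmoothFn φ) {y : Euc n} (hy : y ≠ 0) :
    ContDiffAt ℝ (⊤ : ℕ∞) φ y := ContDiffOn.contDiffAt hs (isOpen_ne_zero.mem_nhds hy)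

lemma SmoothFn.hasFDerivAt (hs : SmoothFn φ) {y : Euc n} (hy : y ≠ 0) :
    HasFDerivAt φ (fderiv ℝ φ y) y :=
  ((hs.contDiffAt hy).differentiableAt (by simp)).hasFDerivAt

lemma SmoothFn.hasFDerivAt_fderiv (hs : SmoothFn φ) {y : Euc n} (hy : y ≠ 0) :
    HasFDerivAt (fderiv ℝ φ) (secondDeriv φ y) y :=
  ((hs.contDiffOn_fderiv.contDiffAt (isOpen_ne_zero.mem_nhds hy)).differentiableAt
    (by simp)).hasFDerivAt

lemma SmoothFn.differentiableAt_secondDeriv (hs : SmoothFn φ) {y : Euc n} (hy : y ≠ 0) :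
    DifferentiableAt ℝ (secondDeriv φ) y :=
  (hs.contDiffOn_secondDeriv.contDiffAt (isOpen_ne_zero.mem_nhds hy)).differentiableAt (by simp)

lemma inner_gradient (y v : Euc n) : ⟪gradient φ y, v⟫ = fderiv ℝ φ y v := by
  simp [gradient]

lemma SmoothFn.secondDeriv_symm (hs : SmoothFn φ) {y : Euc n} (hy : y ≠ 0) (v w : Euc n) :
    secondDeriv φ y v w = secondDeriv φ y w v := by
  refine second_derivative_symmetric_of_eventually (f := φ) ?_ (hs.hasFDerivAt_fderiv hy) v w
  filter_upwards [isOpen_ne_zero.mem_nhds hy] with z hz using hs.hasFDerivAt hz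

lemma SmoothFn.thirdDeriv_symm_left (hs : SmoothFn φ) {y : Euc n} (hy : y ≠ 0) (u v w : Euc n) :
    thirdDeriv φ y u v w = thirdDeriv φ y v u w := by
  have := second_derivative_symmetric_of_eventually (f := fderiv ℝ φ) ?_
    (hs.differentiableAt_secondDeriv hy).hasFDerivAt u v
  · rw [thirdDeriv, this, thirdDeriv]
  · filter_upwards [isOpen_ne_zero.mem_nhds hy] with z hz using hs.hasFDerivAt_fderiv hz

lemma Homog0.fderiv_self (hh : Homog0 φ) (hs : SmoothFn φ) (y : Euc n) : fderiv ℝ φ y y = 0 := by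
  rcases eq_or_ne y 0 with rfl | hy
  · simp
  have h1 : HasDerivAt (fun t : ℝ => φ (t • y)) (fderiv ℝ φ y y) 1 := by
    have h0 : HasDerivAt (fun t : ℝ => t • y) y 1 := by
      simpa using (hasDerivAt_id (1 : ℝ)).smul_const y
    have h2 : HasFDerivAt φ (fderiv ℝ φ y) ((1 : ℝ) • y) := by
      rw [one_smul]; exact hs.hasFDerivAt hy
    exact h2.comp_hasDerivAt 1 h0
  have h2 : (fun t : ℝ => φ (t • y)) =ᶠ[nhds 1] fun _ => φ y := by
    filter_upwards [lt_mem_nhds one_pos] with t ht using hh t y ht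
  exact h1.unique ((hasDerivAt_const (1 : ℝ) (φ y)).congr_of_eventuallyEq h2)

lemma Homog0.secondDeriv_self_right (hh : Homog0 φ) (hs : SmoothFn φ) {y : Euc n} (hy : y ≠ 0)
    (v : Euc n) : secondDeriv φ y v y = -fderiv ℝ φ y v := by
  have h1 := (hs.hasFDerivAt_fderiv hy).clm_apply (hasFDerivAt_id y)
  have h2 : (fun z => fderiv ℝ φ z (id z)) = fun _ => (0 : ℝ) :=
    funext fun z => hh.fderiv_self hs z
  rw [h2] at h1
  have h3 := congrArg (fun T : Euc n →L[ℝ] ℝ => T v) (h1.unique (hasFDerivAt_const (0 : ℝ) y))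
  simp at h3
  linarith

lemma Homog0.inner_gradient_self (hh : Homog0 φ) (hs : SmoothFn φ) (y : Euc n) :
    ⟪y, gradient φ y⟫ = 0 := by
  rw [real_inner_comm, inner_gradient, hh.fderiv_self hs]

lemma Homog0.covD_eq (hh : Homog0 φ) (hs : SmoothFn φ) (y w : Euc n) :
    covD φ y w = fderiv ℝ φ y w := by
  simp [covD, tanProj, hh.fderiv_self hs]

lemma tanProj_of_inner_eq_zero {x v : Euc n} (h : ⟪x, v⟫ = 0) : tanProj x v = v := by
  simp [tanProj, h]

lemma Homog0.aform_eq (hh : Homog0 φ) (hs : SmoothFn φ) {x v w : Euc n} (hx : ‖x‖ = 1)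
    (hv : ⟪x, v⟫ = 0) (hw : ⟪x, w⟫ = 0) :
    Aform φ x v w = secondDeriv φ x v w + metricCoeff φ x * ⟪v, w⟫ := by
  have hx0 := ne_zero_of_norm_eq_one hx
  have h1 : hessS φ x v w = secondDeriv φ x v w := by
    rw [hessS, tanProj_of_inner_eq_zero hv, show (fun y => covD φ y w) = fun y => fderiv ℝ φ y w
      from funext fun y => hh.covD_eq hs y w]
    have := (hs.hasFDerivAt_fderiv hx0).clm_apply (hasFDerivAt_const w x)
    rw [this.fderiv]; simp
  rw [Aform, h1, tanProj_of_inner_eq_zero hv, tanProj_of_inner_eq_zero hw, gradS,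
    tanProj_of_inner_eq_zero (hh.inner_gradient_self hs x), metricCoeff]

lemma EvenFn.fderiv_neg (hs : SmoothFn φ) (he : EvenFn φ) {y : Euc n} (hy : y ≠ 0) :
    fderiv ℝ φ (-y) = -fderiv ℝ φ y := by
  have h := (hs.hasFDerivAt (neg_ne_zero.2 hy)).comp y (hasFDerivAt_id y).neg
  have h' : HasFDerivAt φ ((fderiv ℝ φ (-y)).comp (-ContinuousLinearMap.id ℝ (Euc n))) y :=
    h.congr_of_eventuallyEq (Filter.Eventually.of_forall fun z => (he z).symm)
  have h2 := h'.unique (hs.hasFDerivAt hy)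
  rw [← h2]
  ext v; simp

lemma EvenFn.secondDeriv_neg (hs : SmoothFn φ) (he : EvenFn φ) {y : Euc n} (hy : y ≠ 0) :
    secondDeriv φ (-y) = secondDeriv φ y := by
  have h := ((hs.hasFDerivAt_fderiv (neg_ne_zero.2 hy)).comp y (hasFDerivAt_id y).neg).neg
  have h' : HasFDerivAt (fderiv ℝ φ)
      (-((secondDeriv φ (-y)).comp (-ContinuousLinearMap.id ℝ (Euc n)))) y := by
    refine h.congr_of_eventuallyEq ?_
    filter_upwards [isOpen_ne_zero.mem_nhds hy] with z hz
    simp [EvenFn.fderiv_neg hs he hz]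
  have h2 := h'.unique (hs.hasFDerivAt_fderiv hy)
  rw [← h2]
  ext v; simp

end Calculus

section AlongCurves

variable {n : ℕ} {φ : Euc n → ℝ} {γ : ℝ → Euc n} {γ' : Euc n} {t : ℝ}

lemma SmoothFn.hasDerivAt_comp (hs : SmoothFn φ) (hγ : HasDerivAt γ γ' t) (h0 : γ t ≠ 0) :
    HasDerivAt (fun s => φ (γ s)) (fderiv ℝ φ (γ t) γ') t :=
  (hs.hasFDerivAt h0).comp_hasDerivAt t hγ

lemma SmoothFn.hasDerivAt_fderiv_comp (hs : SmoothFn φ) {v : ℝ → Euc n} {v' : Euc n}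
    (hγ : HasDerivAt γ γ' t) (h0 : γ t ≠ 0) (hv : HasDerivAt v v' t) :
    HasDerivAt (fun s => fderiv ℝ φ (γ s) (v s))
      (secondDeriv φ (γ t) γ' (v t) + fderiv ℝ φ (γ t) v') t :=
  ((hs.hasFDerivAt_fderiv h0).comp_hasDerivAt t hγ).clm_apply hv

lemma DifferentiableAt.hasDerivAt_comp {F : Type*} [NormedAddCommGroup F] [NormedSpace ℝ F]
    {g : Euc n → F} (hg : DifferentiableAt ℝ g (γ t)) (hγ : HasDerivAt γ γ' t) :
    HasDerivAt (fun s => g (γ s)) (fderiv ℝ g (γ t) γ') t :=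
  hg.hasFDerivAt.comp_hasDerivAt t hγ

lemma HasDerivAt.clm_apply_apply {E : Type*} [NormedAddCommGroup E] [NormedSpace ℝ E]
    {B : ℝ → E →L[ℝ] E →L[ℝ] ℝ} {B' : E →L[ℝ] E →L[ℝ] ℝ} {v w : ℝ → E} {v' w' : E} {t : ℝ}
    (hB : HasDerivAt B B' t) (hv : HasDerivAt v v' t) (hw : HasDerivAt w w' t) :
    HasDerivAt (fun s => B s (v s) (w s)) (B' (v t) (w t) + B t v' (w t) + B t (v t) w') t := by
  have h := (hB.clm_apply hv).clm_apply hw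
  exact h

lemma SmoothFn.hasDerivAt_secondDeriv_comp (hs : SmoothFn φ) {v w : ℝ → Euc n} {v' w' : Euc n}
    (hγ : HasDerivAt γ γ' t) (h0 : γ t ≠ 0) (hv : HasDerivAt v v' t) (hw : HasDerivAt w w' t) :
    HasDerivAt (fun s => secondDeriv φ (γ s) (v s) (w s))
      (thirdDeriv φ (γ t) γ' (v t) (w t) + secondDeriv φ (γ t) v' (w t)
        + secondDeriv φ (γ t) (v t) w') t := by
  have h := DifferentiableAt.hasDerivAt_comp (F := Euc n →L[ℝ] Euc n →L[ℝ] ℝ)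
    (hs.differentiableAt_secondDeriv h0) hγ
  exact h.clm_apply_apply hv hw

lemma SmoothFn.thirdDeriv_symm_right (hs : SmoothFn φ) {y : Euc n} (hy : y ≠ 0) (u v w : Euc n) :
    thirdDeriv φ y u v w = thirdDeriv φ y u w v := by
  have hγ : HasDerivAt (fun t : ℝ => y + t • u) u 0 := by
    simpa using ((hasDerivAt_id (0 : ℝ)).smul_const u).const_add y
  have h0 : y + (0 : ℝ) • u ≠ 0 := by simpa using hy
  have h1 := hs.hasDerivAt_secondDeriv_comp hγ h0 (hasDerivAt_const 0 v) (hasDerivAt_const 0 w)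
  have h2 := hs.hasDerivAt_secondDeriv_comp hγ h0 (hasDerivAt_const 0 w) (hasDerivAt_const 0 v)
  have h3 : (fun t : ℝ => secondDeriv φ (y + t • u) v w)
      =ᶠ[nhds 0] fun t => secondDeriv φ (y + t • u) w v := by
    filter_upwards [hγ.continuousAt.preimage_mem_nhds (isOpen_ne_zero.mem_nhds h0)] with z hz
      using hs.secondDeriv_symm hz v w
  simpa using h1.unique (h2.congr_of_eventuallyEq h3)

/-- The vector representing a linear functional. -/
def rieszVec {n : ℕ} (L : Euc n →L[ℝ] ℝ) : Euc n :=
  ∑ i, L (EuclideanSpace.basisFun (Fin (n + 1)) ℝ i) • EuclideanSpace.basisFun (Fin (n + 1)) ℝ i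

lemma inner_rieszVec (L : Euc n →L[ℝ] ℝ) (v : Euc n) : ⟪rieszVec L, v⟫ = L v := by
  conv_rhs => rw [← (EuclideanSpace.basisFun (Fin (n + 1)) ℝ).sum_repr' v]
  rw [rieszVec, sum_inner, map_sum]
  refine sum_congr rfl fun i _ => ?_
  rw [real_inner_smul_left, map_smul, smul_eq_mul, mul_comm]

lemma gradient_eq_rieszVec (y : Euc n) : gradient φ y = rieszVec (fderiv ℝ φ y) :=
  ext_inner_right ℝ fun v => by rw [inner_gradient, inner_rieszVec]

lemma SmoothFn.hasDerivAt_gradient_comp (hs : SmoothFn φ)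
    (hγ : HasDerivAt γ γ' t) (h0 : γ t ≠ 0) :
    HasDerivAt (fun s => gradient φ (γ s)) (rieszVec (secondDeriv φ (γ t) γ')) t := by
  rw [show (fun s => gradient φ (γ s)) = fun s => rieszVec (fderiv ℝ φ (γ s)) from
    funext fun s => gradient_eq_rieszVec (γ s)]
  refine HasDerivAt.fun_sum fun i _ => ?_
  have := hs.hasDerivAt_fderiv_comp hγ h0
    (hasDerivAt_const t (EuclideanSpace.basisFun (Fin (n + 1)) ℝ i))
  rw [map_zero, add_zero] at this
  exact this.smul_const _

lemma SmoothFn.hasDerivAt_norm_gradient_sq (hs : SmoothFn φ)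
    (hγ : HasDerivAt γ γ' t) (h0 : γ t ≠ 0) :
    HasDerivAt (fun s => ‖gradient φ (γ s)‖ ^ 2)
      (2 * secondDeriv φ (γ t) γ' (gradient φ (γ t))) t := by
  have h := (hs.hasDerivAt_gradient_comp hγ h0).norm_sq
  refine h.congr_deriv ?_
  rw [real_inner_comm, inner_rieszVec]

end AlongCurves

section Frames

variable {n : ℕ}

/-- The linear operator representing a bilinear form. -/
def rieszOp (B : Euc n →L[ℝ] Euc n →L[ℝ] ℝ) : Euc n →ₗ[ℝ] Euc n where
  toFun v := rieszVec (B v)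
  map_add' u v := by simp [rieszVec, add_smul, sum_add_distrib]
  map_smul' c v := by simp [rieszVec, smul_sum, mul_smul]

lemma inner_rieszOp (B : Euc n →L[ℝ] Euc n →L[ℝ] ℝ) (v w : Euc n) :
    ⟪rieszOp B v, w⟫ = B v w := inner_rieszVec (B v) w

lemma sum_apply_self_eq (B : Euc n →L[ℝ] Euc n →L[ℝ] ℝ) {ι : Type*} [Fintype ι]
    (b c : OrthonormalBasis ι ℝ (Euc n)) : ∑ i, B (b i) (b i) = ∑ i, B (c i) (c i) := by
  have h : ∀ b : OrthonormalBasis ι ℝ (Euc n),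
      ∑ i, B (b i) (b i) = LinearMap.trace ℝ _ (rieszOp B) := fun b => by
    rw [LinearMap.trace_eq_sum_inner _ b]
    exact sum_congr rfl fun i _ => by rw [real_inner_comm, inner_rieszOp]
  rw [h b, h c]

lemma sum_sq_apply_eq (L : Euc n →L[ℝ] ℝ) {ι : Type*} [Fintype ι]
    (b : OrthonormalBasis ι ℝ (Euc n)) : ∑ i, L (b i) ^ 2 = ‖rieszVec L‖ ^ 2 := by
  rw [← b.sum_sq_inner_left]
  exact sum_congr rfl fun i _ => by rw [inner_rieszVec]

lemma sum_sum_sq_apply_eq {B : Euc n →L[ℝ] Euc n →L[ℝ] ℝ} (hB : ∀ v w, B v w = B w v)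
    {ι : Type*} [Fintype ι]
    (b c : OrthonormalBasis ι ℝ (Euc n)) :
    ∑ i, ∑ j, B (b i) (b j) ^ 2 = ∑ i, ∑ j, B (c i) (c j) ^ 2 := by
  calc ∑ i, ∑ j, B (b i) (b j) ^ 2 = ∑ i, ∑ j, B (b i) (c j) ^ 2 :=
        sum_congr rfl fun i _ => by rw [sum_sq_apply_eq, sum_sq_apply_eq]
    _ = ∑ j, ∑ i, B (c j) (b i) ^ 2 := by
        rw [sum_comm]
        exact sum_congr rfl fun j _ => sum_congr rfl fun i _ => by rw [hB]
    _ = ∑ i, ∑ j, B (c i) (c j) ^ 2 :=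
        sum_congr rfl fun i _ => by rw [sum_sq_apply_eq, sum_sq_apply_eq]

lemma OrthoFrame.norm_eq_one {x : Euc n} {e : Fin n → Euc n} (he : OrthoFrame x e) (i : Fin n) :
    ‖e i‖ = 1 := by
  have h := he.2 i i
  rw [if_pos rfl, real_inner_self_eq_norm_sq] at h
  nlinarith [norm_nonneg (e i)]

lemma OrthoFrame.orthonormal_cons {x : Euc n} (hx : ‖x‖ = 1) {e : Fin n → Euc n}
    (he : OrthoFrame x e) : Orthonormal ℝ (Fin.cons x e : Fin (n + 1) → Euc n) := by
  rw [orthonormal_iff_ite]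
  intro i j
  refine Fin.cases ?_ (fun i => ?_) i <;> refine Fin.cases ?_ (fun j => ?_) j
  · simp [hx]
  · simp [he.1 j, (Fin.succ_ne_zero j).symm]
  · simp [real_inner_comm, he.1 i]
  · simp [he.2 i j]

/-- The orthonormal basis of the ambient space made of `x` and a tangent frame at `x`. -/
def OrthoFrame.basis {x : Euc n} (hx : ‖x‖ = 1) {e : Fin n → Euc n} (he : OrthoFrame x e) :
    OrthonormalBasis (Fin (n + 1)) ℝ (Euc n) :=
  (basisOfOrthonormalOfCardEqFinrank (he.orthonormal_cons hx) (by simp)).toOrthonormalBasis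
    (by rw [coe_basisOfOrthonormalOfCardEqFinrank]; exact he.orthonormal_cons hx)

lemma OrthoFrame.coe_basis {x : Euc n} (hx : ‖x‖ = 1) {e : Fin n → Euc n} (he : OrthoFrame x e) :
    ⇑(he.basis hx) = Fin.cons x e := by
  simp [OrthoFrame.basis]

lemma OrthoFrame.sum_inner_smul {x : Euc n} (hx : ‖x‖ = 1) {e : Fin n → Euc n}
    (he : OrthoFrame x e) {v : Euc n} (hv : ⟪x, v⟫ = 0) : ∑ i, ⟪e i, v⟫ • e i = v := by
  have h := (he.basis hx).sum_repr' v
  rw [he.coe_basis hx, Fin.sum_univ_succ] at h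
  simpa [hv] using h

lemma OrthoFrame.sum_sq_inner {x : Euc n} (hx : ‖x‖ = 1) {e : Fin n → Euc n}
    (he : OrthoFrame x e) (v : Euc n) : ⟪x, v⟫ ^ 2 + ∑ i, ⟪e i, v⟫ ^ 2 = ‖v‖ ^ 2 := by
  have h := (he.basis hx).sum_sq_inner_right v
  rw [he.coe_basis hx, Fin.sum_univ_succ] at h
  simpa using h

lemma exists_eigenframe {B : Euc n →L[ℝ] Euc n →L[ℝ] ℝ} (hB : ∀ v w, B v w = B w v) {x : Euc n}
    (hx : ‖x‖ = 1) : ∃ (e : Fin n → Euc n) (μ : Fin n → ℝ), OrthoFrame x e ∧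
      ∀ i j, B (e i) (e j) = if i = j then μ i else 0 := by
  let V : Submodule ℝ (Euc n) := (Submodule.span ℝ {x})ᗮ
  have : Fact (Module.finrank ℝ (Euc n) = n + 1) := ⟨by simp⟩
  have hn : Module.finrank ℝ V = n :=
    Submodule.finrank_orthogonal_span_singleton (ne_zero_of_norm_eq_one hx)
  let T : V →ₗ[ℝ] V := (V.orthogonalProjectionOnto : Euc n →ₗ[ℝ] V) ∘ₗ rieszOp B ∘ₗ V.subtype
  have hTB : ∀ v w : V, ⟪T v, w⟫ = B v w := fun v w => by
    rw [← inner_rieszOp, real_inner_comm, real_inner_comm (w : Euc n)]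
    exact V.inner_orthogonalProjectionOnto_eq_of_mem_left w (rieszOp B v)
  have hT : T.IsSymmetric := fun v w => by
    rw [hTB, real_inner_comm, hTB, hB]
  let b := hT.eigenvectorBasis hn
  have hb : ∀ i j, ⟪(b i : Euc n), (b j : Euc n)⟫ = if i = j then (1 : ℝ) else 0 :=
    fun i j => orthonormal_iff_ite.1 b.orthonormal i j
  refine ⟨fun i => b i, hT.eigenvalues hn, ⟨fun i => ?_, hb⟩, fun i j => ?_⟩
  · exact Submodule.mem_orthogonal_singleton_iff_inner_right.1 (b i).2
  · rw [← hTB, hT.apply_eigenvectorBasis hn i, real_inner_smul_left]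
    have : ⟪b i, b j⟫ = if i = j then (1 : ℝ) else 0 := hb i j
    simp only [b] at this
    rw [this]
    simp

end Frames

section SecondDerivativeTest

lemma deriv_test_of_forall_le {g g' : ℝ → ℝ} {c : ℝ} (hg : ∀ t, HasDerivAt g (g' t) t)
    (hg' : HasDerivAt g' c 0) (hmax : ∀ t, g t ≤ g 0) : g' 0 = 0 ∧ c ≤ 0 := by
  have hd : deriv g = g' := funext fun t => (hg t).deriv
  have hm : IsLocalMax g 0 := Filter.Eventually.of_forall hmax
  have h0 : g' 0 = 0 := hm.hasDerivAt_eq_zero (hg 0)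
  refine ⟨h0, ?_⟩
  by_contra! hc
  have hmin : IsLocalMin g 0 := isLocalMin_of_deriv_deriv_pos
    (by rw [hd, hg'.deriv]; exact hc) (by rw [hd, h0]) (hg 0).continuousAt
  have hconst : g =ᶠ[nhds 0] fun _ => g 0 := by
    filter_upwards [hmin, hm] with t h1 h2 using le_antisymm h2 h1
  have h1 : g' =ᶠ[nhds 0] fun _ => 0 := by
    filter_upwards [hconst.eventually_nhds] with t ht
    exact (hg t).unique ((hasDerivAt_const t (g 0)).congr_of_eventuallyEq ht)
  have := hg'.unique ((hasDerivAt_const (0 : ℝ) (0 : ℝ)).congr_of_eventuallyEq h1)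
  linarith

end SecondDerivativeTest

section GreatCircleDerivatives

variable {n : ℕ} {φ : Euc n → ℝ} {x e : Euc n}

lemma hasDerivAt_greatCircle_deriv (t : ℝ) :
    HasDerivAt (greatCircle e (-x)) (-greatCircle x e t) t := by
  rw [← neg_neg_greatCircle]; exact hasDerivAt_greatCircle t

lemma greatCircle_ne_zero (hx : ‖x‖ = 1) (he : ‖e‖ = 1) (hxe : ⟪x, e⟫ = 0) (t : ℝ) :
    greatCircle x e t ≠ 0 := ne_zero_of_norm_eq_one (inner_greatCircle hx he hxe t).1

lemma SmoothFn.hasDerivAt_greatCircle (hs : SmoothFn φ) (hx : ‖x‖ = 1) (he : ‖e‖ = 1)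
    (hxe : ⟪x, e⟫ = 0) (t : ℝ) : HasDerivAt (fun s => φ (greatCircle x e s))
      (fderiv ℝ φ (greatCircle x e t) (greatCircle e (-x) t)) t :=
  hs.hasDerivAt_comp (_root_.hasDerivAt_greatCircle t) (greatCircle_ne_zero hx he hxe t)

lemma Homog0.hasDerivAt_deriv_greatCircle (hh : Homog0 φ) (hs : SmoothFn φ) (hx : ‖x‖ = 1)
    (he : ‖e‖ = 1) (hxe : ⟪x, e⟫ = 0) (t : ℝ) :
    HasDerivAt (fun s => fderiv ℝ φ (greatCircle x e s) (greatCircle e (-x) s))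
      (secondDeriv φ (greatCircle x e t) (greatCircle e (-x) t) (greatCircle e (-x) t)) t := by
  have h := hs.hasDerivAt_fderiv_comp (_root_.hasDerivAt_greatCircle t)
    (greatCircle_ne_zero hx he hxe t) (hasDerivAt_greatCircle_deriv (x := x) (e := e) t)
  refine h.congr_deriv ?_
  rw [map_neg, hh.fderiv_self hs, neg_zero, add_zero]

lemma add_inv_ge_two {a : ℝ} (ha : 0 < a) : 2 ≤ a + a⁻¹ := by
  have h : a + a⁻¹ - 2 = (a - 1) ^ 2 / a := by field_simp; ring
  have : 0 ≤ (a - 1) ^ 2 / a := by positivity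
  linarith

lemma exists_unit_tangent (hn : 1 ≤ n) {x : Euc n} (hx : ‖x‖ = 1) :
    ∃ e : Euc n, ‖e‖ = 1 ∧ ⟪x, e⟫ = 0 := by
  obtain ⟨e, -, he, -⟩ := exists_eigenframe (B := (0 : Euc n →L[ℝ] Euc n →L[ℝ] ℝ))
    (fun _ _ => rfl) hx
  exact ⟨e ⟨0, hn⟩, he.norm_eq_one _, he.1 _⟩

lemma mem_uSphere {x : Euc n} : x ∈ uSphere n ↔ ‖x‖ = 1 := by simp [uSphere]

lemma Homog0.one_lt (hh : Homog0 φ) (hs : SmoothFn φ) (hev : EvenFn φ)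
    (hpos : ∀ x ∈ uSphere n, 0 < φ x) (hc : UnifHConvex φ) (hn : 1 ≤ n) {x : Euc n}
    (hx : ‖x‖ = 1) : 1 < φ x := by
  obtain ⟨e, he, hxe⟩ := exists_unit_tangent hn hx
  have hd : ∀ t, HasDerivAt (fun s => fderiv ℝ φ (greatCircle x e s) (greatCircle e (-x) s)
      * Real.sin s - (φ (greatCircle x e s) - 1) * Real.cos s)
      ((secondDeriv φ (greatCircle x e t) (greatCircle e (-x) t) (greatCircle e (-x) t)
        + φ (greatCircle x e t) - 1) * Real.sin t) t := fun t => by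
    have h := ((hh.hasDerivAt_deriv_greatCircle hs hx he hxe t).mul (Real.hasDerivAt_sin t)).sub
      (((hs.hasDerivAt_greatCircle hx he hxe t).sub_const 1).mul (Real.hasDerivAt_cos t))
    refine h.congr_deriv ?_
    ring
  have hmono := strictMonoOn_of_deriv_pos (convex_Icc 0 Real.pi)
    (fun t _ => (hd t).continuousAt.continuousWithinAt) (fun t ht => by
      rw [interior_Icc] at ht
      rw [(hd t).deriv]
      obtain ⟨h1, h2, h3⟩ := inner_greatCircle hx he hxe t
      refine mul_pos ?_ (Real.sin_pos_of_pos_of_lt_pi ht.1 ht.2)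
      have hA := hc _ (mem_uSphere.2 h1) _ h3 (ne_zero_of_norm_eq_one h2)
      rw [hh.aform_eq hs h1 h3 h3, real_inner_self_eq_norm_sq, h2, metricCoeff] at hA
      have ha := hpos _ (mem_uSphere.2 h1)
      have h4 := add_inv_ge_two ha
      have h5 : 0 ≤ ‖gradient φ (greatCircle x e t)‖ ^ 2 / (2 * φ (greatCircle x e t)) := by
        positivity
      linarith)
  have h := hmono (Set.left_mem_Icc.2 Real.pi_pos.le) (Set.right_mem_Icc.2 Real.pi_pos.le)
    Real.pi_pos
  simp only [greatCircle_zero, greatCircle_pi, Real.sin_zero, Real.cos_zero, Real.sin_pi,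
    Real.cos_pi, hev x] at h
  linarith

end GreatCircleDerivatives

section EquationDerivative

variable {n : ℕ} {φ : Euc n → ℝ} {γ : ℝ → Euc n} {γ' : Euc n} {t : ℝ}

lemma SmoothFn.hasDerivAt_metricCoeff_comp (hs : SmoothFn φ) (hγ : HasDerivAt γ γ' t)
    (h0 : γ t ≠ 0) (hpos : 0 < φ (γ t)) :
    HasDerivAt (fun s => metricCoeff φ (γ s))
      (fderiv ℝ φ (γ t) γ' * (1 + (φ (γ t) ^ 2)⁻¹ + ‖gradient φ (γ t)‖ ^ 2 / φ (γ t) ^ 2) / 2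
        - secondDeriv φ (γ t) γ' (gradient φ (γ t)) / φ (γ t)) t := by
  have h1 := hs.hasDerivAt_comp hγ h0
  have h2 := hs.hasDerivAt_norm_gradient_sq hγ h0
  have h := ((h1.sub (h1.inv hpos.ne')).div_const 2).sub
    (h2.div (h1.const_mul 2) (by positivity))
  refine h.congr_deriv ?_
  have := hpos.ne'
  field_simp
  ring

lemma Homog0.sum_esum_mul_eq (hh : Homog0 φ) (hs : SmoothFn φ) (hpos : ∀ x ∈ uSphere n, 0 < φ x)
    {m : ℕ} {p c : ℝ} (hsol : SolvesCM n (m + 1) p (fun _ => c) φ) {x : Euc n} (hx : ‖x‖ = 1)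
    {e : Fin n → Euc n} {μ : Fin n → ℝ} (he : OrthoFrame x e)
    (hμ : ∀ i j, secondDeriv φ x (e i) (e j) = if i = j then μ i else 0) (l : Fin n) :
    ∑ i, esum (fun i => μ i + metricCoeff φ x) m (univ.erase i) *
        (thirdDeriv φ x (e l) (e i) (e i) + (if i = l then 2 * fderiv ℝ φ x (e l) else 0)
          + (fderiv ℝ φ x (e l) * (1 + (φ x ^ 2)⁻¹ + ‖gradient φ x‖ ^ 2 / φ x ^ 2) / 2
            - secondDeriv φ x (e l) (gradient φ x) / φ x))
      = c * ((p - (m + 1)) * φ x ^ (p - (m + 1)) * fderiv ℝ φ x (e l) / φ x) := by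
  have hel := he.norm_eq_one l
  have hxl := he.1 l
  have hx0 := ne_zero_of_norm_eq_one hx
  set E : ℝ → Fin n → Euc n := fun t i => if i = l then greatCircle (e l) (-x) t else e i with hE
  have hE0 : ∀ i, E 0 i = e i := fun i => by
    by_cases h : i = l
    · simp [hE, h, greatCircle_zero]
    · simp [hE, h]
  have hE' : ∀ i, HasDerivAt (fun t => E t i) (if i = l then -x else 0) 0 := fun i => by
    by_cases h : i = l
    · simp only [hE, h, if_true]
      have := hasDerivAt_greatCircle_deriv (x := x) (e := e l) 0
      rwa [greatCircle_zero] at this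
    · simp only [hE, h, if_false]
      exact hasDerivAt_const _ _
  have hframe : ∀ t, OrthoFrame (greatCircle x (e l) t) (E t) := fun t => by
    obtain ⟨h1, h2, h3⟩ := inner_greatCircle hx hel hxl t
    have hperp : ∀ i, i ≠ l → ⟪e i, x⟫ = 0 ∧ ⟪e i, e l⟫ = 0 := fun i hi =>
      ⟨by rw [real_inner_comm]; exact he.1 i, by rw [he.2, if_neg hi]⟩
    have hperp1 : ∀ i, i ≠ l → ⟪e i, greatCircle x (e l) t⟫ = 0 := fun i hi => by
      simp [greatCircle, inner_add_right, real_inner_smul_right, hperp i hi]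
    have hperp2 : ∀ i, i ≠ l → ⟪e i, greatCircle (e l) (-x) t⟫ = 0 := fun i hi => by
      simp [greatCircle, inner_add_right, real_inner_smul_right, hperp i hi]
    refine ⟨fun i => ?_, fun i j => ?_⟩
    · by_cases hi : i = l
      · simpa only [hE, hi, if_true] using h3
      · simp only [hE, hi, if_false]
        rw [real_inner_comm]; exact hperp1 i hi
    · by_cases hi : i = l <;> by_cases hj : j = l
      · simp [hE, hi, hj, h2]
      · have : l ≠ j := fun h => hj h.symm
        simp only [hE, hi, hj, if_true, if_false, this]
        rw [real_inner_comm]; exact hperp2 j hj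
      · simp only [hE, hi, hj, if_true, if_false]
        exact hperp2 i hi
      · simp only [hE, hi, hj, if_false]
        exact he.2 i j
  have hγ := hasDerivAt_greatCircle (x := x) (e := e l) 0
  rw [greatCircle_zero] at hγ
  have hg0 : greatCircle x (e l) 0 = x := greatCircle_zero
  have hg00 : greatCircle x (e l) 0 ≠ 0 := by rw [hg0]; exact hx0
  have hφx : 0 < φ (greatCircle x (e l) 0) := by rw [hg0]; exact hpos x (mem_uSphere.2 hx)
  have hs0 := hs.hasDerivAt_metricCoeff_comp hγ hg00 hφx
  rw [hg0] at hs0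
  have hM : ∀ i j, HasDerivAt (fun t => secondDeriv φ (greatCircle x (e l) t) (E t i) (E t j)
      + metricCoeff φ (greatCircle x (e l) t) * (if i = j then 1 else 0)) (Matrix.of (fun i j =>
        thirdDeriv φ x (e l) (e i) (e j)
        + secondDeriv φ x (if i = l then -x else 0) (e j)
        + secondDeriv φ x (e i) (if j = l then -x else 0)
        + (fderiv ℝ φ x (e l) * (1 + (φ x ^ 2)⁻¹ + ‖gradient φ x‖ ^ 2 / φ x ^ 2) / 2
            - secondDeriv φ x (e l) (gradient φ x) / φ x) * (if i = j then 1 else 0)) i j) 0 := by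
    intro i j
    have h := hs.hasDerivAt_secondDeriv_comp hγ hg00 (hE' i) (hE' j)
    rw [hg0, hE0, hE0] at h
    exact h.add (hs0.mul_const _)
  have hdiag : ∀ i j, (Matrix.of fun i j => secondDeriv φ (greatCircle x (e l) 0) (E 0 i) (E 0 j)
      + metricCoeff φ (greatCircle x (e l) 0) * (if i = j then 1 else 0)) i j
      = if i = j then μ i + metricCoeff φ x else 0 := fun i j => by
    rw [Matrix.of_apply, hg0, hE0, hE0, hμ]
    split_ifs <;> simp
  have hL := hasDerivAt_sigmaMat_of_diagonal (M := fun t => Matrix.of fun i j =>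
    secondDeriv φ (greatCircle x (e l) t) (E t i) (E t j)
      + metricCoeff φ (greatCircle x (e l) t) * (if i = j then 1 else 0)) hM hdiag m
  have heq : (fun t => sigmaMat (m + 1) (Matrix.of fun i j =>
      secondDeriv φ (greatCircle x (e l) t) (E t i) (E t j)
      + metricCoeff φ (greatCircle x (e l) t) * (if i = j then 1 else 0)))
      = fun t => φ (greatCircle x (e l) t) ^ (p - (m + 1)) * c := by
    funext t
    have h1 := (inner_greatCircle hx hel hxl t).1
    have h2 := hsol _ (mem_uSphere.2 h1) _ (hframe t)
    rw [Nat.cast_succ] at h2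
    rw [← h2]
    congr 1
    ext i j
    rw [Amat, Matrix.of_apply, Matrix.of_apply,
      hh.aform_eq hs h1 ((hframe t).1 i) ((hframe t).1 j), (hframe t).2 i j]
  rw [heq] at hL
  have hR := ((hs.hasDerivAt_comp hγ hg00).rpow_const (p := p - (m + 1))
    (Or.inl hφx.ne')).mul_const c
  have h := hL.unique hR
  rw [hg0] at h hφx
  calc _ = _ := sum_congr rfl fun i _ => ?_
    _ = _ := h
    _ = _ := ?_
  · congr 1
    simp only [Matrix.of_apply, if_true, mul_one]
    by_cases hi : i = l
    · subst hi
      simp only [if_true, map_neg, neg_apply,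
        hh.secondDeriv_self_right hs hx0, hs.secondDeriv_symm hx0 x]
      ring
    · simp [hi]
  · rw [Real.rpow_sub_one hφx.ne']
    field_simp

end EquationDerivative

/-- The auxiliary function `|Dφ|²/(2φ) + (φ + 1/φ)/2 + G(φ)`. -/
def testFn {n : ℕ} (G : ℝ → ℝ) (φ : Euc n → ℝ) (y : Euc n) : ℝ :=
  ‖gradient φ y‖ ^ 2 / (2 * φ y) + (φ y + (φ y)⁻¹) / 2 + G (φ y)

section TestFunction

variable {n : ℕ} {φ : Euc n → ℝ} {G G' : ℝ → ℝ}

lemma SmoothFn.hasDerivAt_testFn_comp (hs : SmoothFn φ) (hG : ∀ a, 0 < a → HasDerivAt G (G' a) a)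
    {γ : ℝ → Euc n} {γ' : Euc n} {t : ℝ} (hγ : HasDerivAt γ γ' t) (h0 : γ t ≠ 0)
    (hpos : 0 < φ (γ t)) :
    HasDerivAt (fun s => testFn G φ (γ s))
      (secondDeriv φ (γ t) γ' (gradient φ (γ t)) / φ (γ t)
        + fderiv ℝ φ (γ t) γ' * ((1 - (φ (γ t) ^ 2)⁻¹) / 2 + G' (φ (γ t))
          - ‖gradient φ (γ t)‖ ^ 2 / (2 * φ (γ t) ^ 2))) t := by
  have h1 := hs.hasDerivAt_comp hγ h0
  have h2 := hs.hasDerivAt_norm_gradient_sq hγ h0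
  have h := ((h2.div (h1.const_mul 2) (by positivity)).add
    ((h1.add (h1.inv hpos.ne')).div_const 2)).add ((hG _ hpos).comp t h1)
  refine h.congr_deriv ?_
  have := hpos.ne'
  field_simp
  ring

lemma Homog0.hasDerivAt_secondDeriv_gradient (hh : Homog0 φ) (hs : SmoothFn φ) {x e : Euc n}
    (hx : ‖x‖ = 1) : HasDerivAt (fun s => secondDeriv φ (greatCircle x e s)
      (greatCircle e (-x) s) (gradient φ (greatCircle x e s)))
      (thirdDeriv φ x e e (gradient φ x) + ‖gradient φ x‖ ^ 2
        + ‖rieszVec (secondDeriv φ x e)‖ ^ 2) 0 := by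
  have hx0 := ne_zero_of_norm_eq_one hx
  have hγ := hasDerivAt_greatCircle (x := x) (e := e) 0
  have hγ' := hasDerivAt_greatCircle_deriv (x := x) (e := e) 0
  have hg0 : greatCircle x e 0 = x := greatCircle_zero
  have hg0' : greatCircle e (-x) 0 = e := greatCircle_zero
  rw [hg0'] at hγ
  rw [hg0] at hγ'
  have hg00 : greatCircle x e 0 ≠ 0 := by rwa [hg0]
  have h := hs.hasDerivAt_secondDeriv_comp hγ hg00 hγ' (hs.hasDerivAt_gradient_comp hγ hg00)
  rw [hg0, hg0'] at h
  refine h.congr_deriv ?_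
  rw [map_neg, neg_apply, hs.secondDeriv_symm hx0 x, hh.secondDeriv_self_right hs hx0,
    ← inner_gradient, ← inner_rieszVec (secondDeriv φ x e), real_inner_self_eq_norm_sq,
    real_inner_self_eq_norm_sq, neg_neg]

lemma Homog0.max_conditions (hh : Homog0 φ) (hs : SmoothFn φ) (hpos : ∀ x ∈ uSphere n, 0 < φ x)
    (hG : ∀ a, 0 < a → HasDerivAt G (G' a) a) {G'' : ℝ} {x z e : Euc n} (hx : ‖x‖ = 1)
    (hG' : HasDerivAt G' G'' (φ x)) (he : ‖e‖ = 1) (hxe : ⟪x, e⟫ = 0) {ε α μ : ℝ}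
    (hmax : ∀ y, ‖y‖ = 1 → testFn G φ y + ε * Real.exp (α * ⟪z, y⟫)
      ≤ testFn G φ x + ε * Real.exp (α * ⟪z, x⟫))
    (h1 : secondDeriv φ x e e = μ)
    (h2 : secondDeriv φ x e (gradient φ x) = μ * fderiv ℝ φ x e)
    (h3 : ‖rieszVec (secondDeriv φ x e)‖ ^ 2 = μ ^ 2 + fderiv ℝ φ x e ^ 2) :
    fderiv ℝ φ x e * ((μ + metricCoeff φ x) / φ x + G' (φ x))
        = -(ε * Real.exp (α * ⟪z, x⟫) * (α * ⟪z, e⟫)) ∧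
      (μ + metricCoeff φ x) * μ / φ x + 2 * fderiv ℝ φ x e ^ 2 / φ x
        + (thirdDeriv φ x e e (gradient φ x) + ‖gradient φ x‖ ^ 2) / φ x
        - 2 * (μ + metricCoeff φ x) * fderiv ℝ φ x e ^ 2 / φ x ^ 2
        + G' (φ x) * μ + G'' * fderiv ℝ φ x e ^ 2
        ≤ -(ε * Real.exp (α * ⟪z, x⟫) * (α ^ 2 * ⟪z, e⟫ ^ 2 - α * ⟪z, x⟫)) := by
  have hx0 := ne_zero_of_norm_eq_one hx
  have ha := hpos x (mem_uSphere.2 hx)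
  have hg0 : greatCircle x e 0 = x := greatCircle_zero
  have hg0' : greatCircle e (-x) 0 = e := greatCircle_zero
  have hin : ∀ t, HasDerivAt (fun s => α * ⟪z, greatCircle x e s⟫)
      (α * ⟪z, greatCircle e (-x) t⟫) t := fun t => by
    have := ((hasDerivAt_const t z).inner ℝ (hasDerivAt_greatCircle (x := x) (e := e) t))
    simpa using this.const_mul α
  have hin' : HasDerivAt (fun s => α * ⟪z, greatCircle e (-x) s⟫) (-(α * ⟪z, x⟫)) 0 := by
    have := ((hasDerivAt_const (0 : ℝ) z).inner ℝ
      (hasDerivAt_greatCircle_deriv (x := x) (e := e) 0))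
    simpa [hg0] using this.const_mul α
  have hexp : ∀ t, HasDerivAt (fun s => ε * Real.exp (α * ⟪z, greatCircle x e s⟫))
      (ε * (Real.exp (α * ⟪z, greatCircle x e t⟫) * (α * ⟪z, greatCircle e (-x) t⟫))) t :=
    fun t => (hin t).exp.const_mul ε
  have hW : ∀ t, HasDerivAt (fun s => testFn G φ (greatCircle x e s)) _ t := fun t =>
    hs.hasDerivAt_testFn_comp hG (hasDerivAt_greatCircle t) (greatCircle_ne_zero hx he hxe t)
      (hpos _ (mem_uSphere.2 (inner_greatCircle hx he hxe t).1))
  have hφ := hs.hasDerivAt_greatCircle hx he hxe 0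
  have hφ' := hh.hasDerivAt_deriv_greatCircle hs hx he hxe 0
  have hA := hh.hasDerivAt_secondDeriv_gradient hs (e := e) hx
  have hN := hs.hasDerivAt_norm_gradient_sq (hasDerivAt_greatCircle (x := x) (e := e) 0)
    (greatCircle_ne_zero hx he hxe 0)
  have hGφ : HasDerivAt (fun s => G' (φ (greatCircle x e s)))
      (G'' * fderiv ℝ φ (greatCircle x e 0) (greatCircle e (-x) 0)) 0 :=
    HasDerivAt.comp (h₂ := G') 0 (by rw [hg0]; exact hG') hφ
  have ha0 : φ (greatCircle x e 0) ≠ 0 := by rw [hg0]; exact ha.ne'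
  have hW' := (hA.div hφ ha0).add (hφ'.mul ((((((hφ.pow 2).inv (pow_ne_zero 2 ha0)).const_sub
    1).div_const 2).add hGφ).sub (hN.div ((hφ.pow 2).const_mul 2)
      (mul_ne_zero two_ne_zero (pow_ne_zero 2 ha0)))))
  have hE' : HasDerivAt (fun t => ε * (Real.exp (α * ⟪z, greatCircle x e t⟫)
      * (α * ⟪z, greatCircle e (-x) t⟫))) _ 0 := ((hin 0).exp.mul hin').const_mul ε
  obtain ⟨c1, c2⟩ := deriv_test_of_forall_le (fun t => (hW t).add (hexp t)) (hW'.add hE')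
    (fun t => by
      simpa only [Pi.add_apply, hg0] using hmax _ (inner_greatCircle hx he hxe t).1)
  simp only [Pi.add_apply, hg0, hg0', h1, h2, h3, Pi.pow_apply, Pi.sub_apply, Pi.inv_apply,
    Pi.div_apply] at c1 c2
  have ha' := ha.ne'
  constructor
  · rw [metricCoeff]
    refine Eq.trans ?_ (eq_neg_of_add_eq_zero_left c1 |>.trans ?_)
    · field_simp
      ring
    · ring
  · refine le_trans (le_of_eq ?_) ((le_neg_iff_add_nonpos_right.2 c2).trans
      (le_of_eq ?_))
    · rw [metricCoeff]
      field_simp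
      ring
    · ring

end TestFunction

section MaximumInequality

variable {n m : ℕ} {l v τ P Q : Fin n → ℝ} {a b s f p q D : ℝ}

lemma sum_esum_mul_second (ha : 0 < a) (hq : p = q * (m + 1)) (hD : D = ∑ i, v i ^ 2)
    (hτ : ∑ i, esum l m (univ.erase i) * τ i
      = (p - (m + 1)) * esum l (m + 1) univ * D / a
        - (∑ i, esum l m (univ.erase i)) * ∑ i, v i ^ 2 * (1 - l i / a)
        - 2 * ∑ i, esum l m (univ.erase i) * v i ^ 2) :
    ∑ i, esum l m (univ.erase i) * (l i * (l i - s) / a + 2 * v i ^ 2 / a + (τ i + D) / a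
        - 2 * l i * v i ^ 2 / a ^ 2 + (-(f / a)) * (l i - s) + (-((q - 2) * f / a ^ 2)) * v i ^ 2)
      = (∑ i, esum l m (univ.erase i) * l i ^ 2 - f * ((m + 1) * esum l (m + 1) univ)) / a
        + (s + D / a) / a * (f * ∑ i, esum l m (univ.erase i) - (m + 1) * esum l (m + 1) univ)
        + q / a ^ 2 * ∑ i, v i ^ 2
          * ((m + 1) * esum l (m + 1) univ - l i * esum l m (univ.erase i))
        + ∑ i, v i * (l i / a + (-(f / a))) * v i * (∑ j, esum l m (univ.erase j)
          - 2 * esum l m (univ.erase i) + q * esum l m (univ.erase i)) / a := by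
  have hE := sum_mul_esum_erase (l := l) univ m
  set S : Fin n → ℝ := fun i => esum l m (univ.erase i) with hS
  set F := esum l (m + 1) univ
  set T := ∑ i, S i with hT
  have e1 : ∑ i, S i * (l i * (l i - s) / a + 2 * v i ^ 2 / a + (τ i + D) / a
        - 2 * l i * v i ^ 2 / a ^ 2 + (-(f / a)) * (l i - s) + (-((q - 2) * f / a ^ 2)) * v i ^ 2)
      = (∑ i, S i * l i ^ 2) / a - (s / a + f / a) * (∑ i, l i * S i)
        + (2 / a - (q - 2) * f / a ^ 2) * (∑ i, S i * v i ^ 2) + (∑ i, S i * τ i) / a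
        + (D / a + f * s / a) * T - 2 / a ^ 2 * ∑ i, S i * l i * v i ^ 2 := by
    simp only [hT, sum_div, mul_sum, ← sum_add_distrib, ← sum_sub_distrib]
    exact sum_congr rfl fun i _ => by ring
  have e2 : ∑ i, v i ^ 2 * (1 - l i / a) = D - (∑ i, l i * v i ^ 2) / a := by
    simp only [hD, sum_div, ← sum_sub_distrib]
    exact sum_congr rfl fun i _ => by ring
  have e3 : ∑ i, v i ^ 2 * ((m + 1) * F - l i * S i)
      = (m + 1) * F * D - ∑ i, S i * l i * v i ^ 2 := by
    simp only [hD, mul_sum, ← sum_sub_distrib]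
    exact sum_congr rfl fun i _ => by ring
  have e4 : ∑ i, v i * (l i / a + (-(f / a))) * v i * (T - 2 * S i + q * S i) / a
      = T / a ^ 2 * ∑ i, l i * v i ^ 2 - f * T / a ^ 2 * D
        + (q - 2) / a ^ 2 * ∑ i, S i * l i * v i ^ 2
        - (q - 2) * f / a ^ 2 * ∑ i, S i * v i ^ 2 := by
    simp only [hD, mul_sum, ← sum_add_distrib, ← sum_sub_distrib]
    exact sum_congr rfl fun i _ => by ring
  rw [e1, e3, e4, hτ, e2, hE, hq]
  field_simp
  ring

lemma le_of_max_conditions (hm : m + 2 ≤ n) (ha : 0 < a) (hb : 0 < b) (hl : ∀ i, b ≤ l i)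
    (hf : 0 < f) (hq0 : 0 ≤ q) (hq : p = q * (m + 1)) (hD : D = ∑ i, v i ^ 2) (hu : 0 ≤ s + D / a)
    (hF : esum l (m + 1) univ = (n.choose (m + 1) : ℝ) * f ^ (m + 1))
    (hτ : ∑ i, esum l m (univ.erase i) * τ i
      = (p - (m + 1)) * esum l (m + 1) univ * D / a
        - (∑ i, esum l m (univ.erase i)) * ∑ i, v i ^ 2 * (1 - l i / a)
        - 2 * ∑ i, esum l m (univ.erase i) * v i ^ 2)
    (hP : ∀ i, v i * (l i / a + (-(f / a))) = -P i)
    (hQ : ∀ i, l i * (l i - s) / a + 2 * v i ^ 2 / a + (τ i + D) / a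
        - 2 * l i * v i ^ 2 / a ^ 2 + (-(f / a)) * (l i - s) + (-((q - 2) * f / a ^ 2)) * v i ^ 2
        ≤ -Q i) :
    b ^ m / (n * a) * (n * ∑ i, l i ^ 2 - (∑ i, l i) ^ 2) + q * b ^ (m + 1) / a ^ 2 * D
      ≤ ∑ i, P i * v i * (∑ j, esum l m (univ.erase j)
          - 2 * esum l m (univ.erase i) + q * esum l m (univ.erase i)) / a
        - ∑ i, esum l m (univ.erase i) * Q i := by
  have hn : (0 : ℝ) < n := by exact_mod_cast (by omega : 0 < n)
  have hl0 : ∀ i ∈ (univ : Finset (Fin n)), 0 < l i := fun i _ => hb.trans_le (hl i)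
  have hcard : (univ : Finset (Fin n)).card = n := by simp
  have hS : ∀ i, 0 ≤ esum l m (univ.erase i) := fun i =>
    esum_nonneg (fun j _ => (hl0 j (mem_univ j)).le) m
  have h1 := esum_chebyshev hb (s := univ) (fun i _ => hl i) (m := m) (by rwa [hcard])
  have h2 := le_emean_one_of_esum_eq (s := univ) hl0 (m := m) (f := f) (by rw [hcard]; omega)
    (by rwa [hcard])
  have h3 := le_mul_sum_esum_erase (s := univ) hl0 (m := m) hf (by rw [hcard]; omega)
    (by rwa [hcard])
  have h4 := fun i => le_sum_mul_esum_erase_sub (s := univ) hb (fun i _ => hl i) (m := m)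
    (by rwa [hcard]) (mem_univ i)
  rw [hcard] at h1 h2
  have hF0 : 0 ≤ esum l (m + 1) univ := esum_nonneg (fun j hj => (hl0 j hj).le) _
  have key := sum_esum_mul_second (s := s) (f := f) ha hq hD hτ
  have hle := sum_le_sum fun i (_ : i ∈ (univ : Finset (Fin n))) =>
    mul_le_mul_of_nonneg_left (hQ i) (hS i)
  rw [key] at hle
  simp only [hP, mul_neg, neg_mul, sum_neg_distrib, neg_div] at hle
  have t1 : b ^ m / (n * a) * (n * ∑ i, l i ^ 2 - (∑ i, l i) ^ 2)
      ≤ (∑ i, esum l m (univ.erase i) * l i ^ 2 - f * ((m + 1) * esum l (m + 1) univ)) / a := by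
    rw [div_mul_eq_mul_div, div_le_div_iff₀ (by positivity) ha]
    have h5 := mul_le_mul_of_nonneg_right h2
      (by positivity : 0 ≤ ((m : ℝ) + 1) * esum l (m + 1) univ)
    have h6 : b ^ m * (n * ∑ i, l i ^ 2 - (∑ i, l i) ^ 2) ≤ n * (∑ i, esum l m (univ.erase i)
        * l i ^ 2 - f * ((m + 1) * esum l (m + 1) univ)) := by linarith
    calc _ ≤ _ := mul_le_mul_of_nonneg_right h6 ha.le
      _ = _ := by ring
  have t2 : 0 ≤ (s + D / a) / a * (f * ∑ i, esum l m (univ.erase i)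
      - (m + 1) * esum l (m + 1) univ) :=
    mul_nonneg (div_nonneg hu ha.le) (sub_nonneg.2 h3)
  have t3 : q * b ^ (m + 1) / a ^ 2 * D ≤ q / a ^ 2 * ∑ i, v i ^ 2
      * ((m + 1) * esum l (m + 1) univ - l i * esum l m (univ.erase i)) := by
    rw [mul_comm q, mul_div_assoc, mul_comm (b ^ (m + 1)), mul_assoc, hD, mul_sum]
    refine mul_le_mul_of_nonneg_left (sum_le_sum fun i _ => ?_) (by positivity)
    rw [mul_comm]
    exact mul_le_mul_of_nonneg_left (h4 i) (sq_nonneg _)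
  linarith

lemma rhs_le {T L : ℝ} {ρ ψ α : ℝ} {w : Fin n → ℝ} {S : Fin n → ℝ} (ha : 1 ≤ a) (hq0 : 0 ≤ q)
    (hψ : 0 ≤ ψ) (hα : 0 ≤ α) (hS0 : ∀ i, b ≤ S i) (hb : 0 ≤ b) (hT : ∑ i, S i ≤ T)
    (hv : ∀ i, |v i| ≤ L) (hw : ρ ^ 2 + ∑ i, w i ^ 2 = 1) :
    ∑ i, ψ * (α * w i) * v i * (∑ j, S j - 2 * S i + q * S i) / a
        - ∑ i, S i * (ψ * (α ^ 2 * w i ^ 2 - α * ρ))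
      ≤ ψ * α * (n * (L * ((3 + q) * T)) + T - α * b * (1 - ρ ^ 2)) := by
  have hS : ∀ i, 0 ≤ S i := fun i => hb.trans (hS0 i)
  have hsum0 : 0 ≤ ∑ i, S i := sum_nonneg fun i _ => hS i
  have hST : ∀ i, S i ≤ ∑ j, S j := fun i => single_le_sum (fun j _ => hS j) (mem_univ i)
  have hw0 : 0 ≤ ∑ i, w i ^ 2 := sum_nonneg fun i _ => sq_nonneg _
  have hw1 : ∀ i, |w i| ≤ 1 := fun i => by
    have := single_le_sum (f := fun i => w i ^ 2) (fun j _ => sq_nonneg _) (mem_univ i)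
    rw [← sq_le_one_iff_abs_le_one]
    nlinarith [sq_nonneg ρ]
  have hρ : ρ ≤ 1 := by nlinarith
  have h1 : ∀ i, w i * v i * (∑ j, S j - 2 * S i + q * S i) / a ≤ L * ((3 + q) * T) := fun i => by
    have hc : |∑ j, S j - 2 * S i + q * S i| ≤ (3 + q) * T := by
      have := mul_le_mul_of_nonneg_left ((hST i).trans hT) hq0
      have h0 := mul_nonneg hq0 (hS i)
      rw [abs_le]
      constructor <;> nlinarith [hS i, hST i]
    have hT0 : 0 ≤ (3 + q) * T := (abs_nonneg _).trans hc
    have hL : 0 ≤ L := (abs_nonneg _).trans (hv i)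
    calc _ ≤ |w i * v i * (∑ j, S j - 2 * S i + q * S i)| / a :=
          div_le_div_of_nonneg_right (le_abs_self _) (by linarith)
      _ ≤ |w i * v i * (∑ j, S j - 2 * S i + q * S i)| := div_le_self (abs_nonneg _) ha
      _ = |w i| * |v i| * |∑ j, S j - 2 * S i + q * S i| := by rw [abs_mul, abs_mul]
      _ ≤ 1 * L * ((3 + q) * T) := by
          gcongr
          · exact hw1 i
          · exact hv i
      _ = _ := by ring
  have h2 : ∑ i, w i * v i * (∑ j, S j - 2 * S i + q * S i) / a ≤ n * (L * ((3 + q) * T)) := by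
    calc _ ≤ ∑ _i : Fin n, L * ((3 + q) * T) := sum_le_sum fun i _ => h1 i
      _ = _ := by simp
  have h3 : b * (1 - ρ ^ 2) ≤ ∑ i, S i * w i ^ 2 := by
    rw [← hw, add_sub_cancel_left, mul_sum]
    exact sum_le_sum fun i _ => mul_le_mul_of_nonneg_right (hS0 i) (sq_nonneg _)
  have h4 : (∑ i, S i) * ρ ≤ T := by nlinarith
  have e : ∑ i, ψ * (α * w i) * v i * (∑ j, S j - 2 * S i + q * S i) / a
        - ∑ i, S i * (ψ * (α ^ 2 * w i ^ 2 - α * ρ))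
      = ψ * α * (∑ i, w i * v i * (∑ j, S j - 2 * S i + q * S i) / a
        + (∑ i, S i) * ρ - α * ∑ i, S i * w i ^ 2) := by
    have e1 : ∀ U, ∑ i, ψ * (α * w i) * v i * (U - 2 * S i + q * S i) / a
        = ψ * α * ∑ i, w i * v i * (U - 2 * S i + q * S i) / a := fun U => by
      rw [mul_sum]
      exact sum_congr rfl fun i _ => by ring
    have e2 : ∑ i, S i * (ψ * (α ^ 2 * w i ^ 2 - α * ρ))
        = ψ * α * (α * ∑ i, S i * w i ^ 2 - (∑ i, S i) * ρ) := by
      simp only [sum_mul, mul_sum, ← sum_sub_distrib]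
      exact sum_congr rfl fun i _ => by ring
    rw [e1, e2]
    ring
  rw [e]
  refine mul_le_mul_of_nonneg_left ?_ (by positivity)
  have := mul_le_mul_of_nonneg_left h3 hα
  linarith

end MaximumInequality

/-- `n` times the squared norm of the trace-free part of the Hessian of a function on `𝕊ⁿ`, for
0-homogeneous `φ`. -/
def hessDefect {n : ℕ} (φ : Euc n → ℝ) (y : Euc n) : ℝ :=
  n * (∑ i, ∑ j, secondDeriv φ y (EuclideanSpace.basisFun (Fin (n + 1)) ℝ i)
      (EuclideanSpace.basisFun (Fin (n + 1)) ℝ j) ^ 2 - 2 * ‖gradient φ y‖ ^ 2)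
    - (∑ i, secondDeriv φ y (EuclideanSpace.basisFun (Fin (n + 1)) ℝ i)
      (EuclideanSpace.basisFun (Fin (n + 1)) ℝ i)) ^ 2

section Eigenframe

variable {n m : ℕ} {φ : Euc n → ℝ} {x : Euc n} {e : Fin n → Euc n} {μ : Fin n → ℝ} {p c : ℝ}

lemma Homog0.gradient_eq_sum (hh : Homog0 φ) (hs : SmoothFn φ) (hx : ‖x‖ = 1)
    (he : OrthoFrame x e) : gradient φ x = ∑ i, fderiv ℝ φ x (e i) • e i := by
  conv_lhs => rw [← he.sum_inner_smul hx (hh.inner_gradient_self hs x)]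
  refine sum_congr rfl fun i _ => ?_
  rw [real_inner_comm, inner_gradient]

lemma Homog0.norm_gradient_sq (hh : Homog0 φ) (hs : SmoothFn φ) (hx : ‖x‖ = 1)
    (he : OrthoFrame x e) : ‖gradient φ x‖ ^ 2 = ∑ i, fderiv ℝ φ x (e i) ^ 2 := by
  rw [← he.sum_sq_inner hx, hh.inner_gradient_self hs, zero_pow two_ne_zero, zero_add]
  refine sum_congr rfl fun i _ => ?_
  rw [real_inner_comm, inner_gradient]

lemma Homog0.secondDeriv_gradient (hh : Homog0 φ) (hs : SmoothFn φ) (hx : ‖x‖ = 1)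
    (he : OrthoFrame x e) (hμ : ∀ i j, secondDeriv φ x (e i) (e j) = if i = j then μ i else 0)
    (i : Fin n) : secondDeriv φ x (e i) (gradient φ x) = μ i * fderiv ℝ φ x (e i) := by
  rw [hh.gradient_eq_sum hs hx he, map_sum]
  simp only [map_smul, hμ, smul_eq_mul, mul_ite, mul_zero, sum_ite_eq, mem_univ, if_true]
  ring

lemma Homog0.norm_rieszVec_secondDeriv_sq (hh : Homog0 φ) (hs : SmoothFn φ) (hx : ‖x‖ = 1)
    (he : OrthoFrame x e) (hμ : ∀ i j, secondDeriv φ x (e i) (e j) = if i = j then μ i else 0)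
    (i : Fin n) :
    ‖rieszVec (secondDeriv φ x (e i))‖ ^ 2 = μ i ^ 2 + fderiv ℝ φ x (e i) ^ 2 := by
  rw [← sum_sq_apply_eq _ (he.basis hx), he.coe_basis hx, Fin.sum_univ_succ]
  simp [hh.secondDeriv_self_right hs (ne_zero_of_norm_eq_one hx), hμ, add_comm]

lemma Homog0.aform_eigenframe (hh : Homog0 φ) (hs : SmoothFn φ) (hx : ‖x‖ = 1)
    (he : OrthoFrame x e) (hμ : ∀ i j, secondDeriv φ x (e i) (e j) = if i = j then μ i else 0)
    (i j : Fin n) :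
    Aform φ x (e i) (e j) = if i = j then μ i + metricCoeff φ x else 0 := by
  rw [hh.aform_eq hs hx (he.1 i) (he.1 j), hμ, he.2]
  split_ifs <;> simp

lemma Homog0.esum_eq (hh : Homog0 φ) (hs : SmoothFn φ) (hsol : SolvesCM n m p (fun _ => c) φ)
    (hx : ‖x‖ = 1) (he : OrthoFrame x e)
    (hμ : ∀ i j, secondDeriv φ x (e i) (e j) = if i = j then μ i else 0) :
    esum (fun i => μ i + metricCoeff φ x) m univ = φ x ^ (p - m) * c := by
  rw [← hsol x (mem_uSphere.2 hx) e he]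
  exact (sigmaMat_of_diagonal fun i j => hh.aform_eigenframe hs hx he hμ i j) m |>.symm

lemma Homog0.hessDefect_eq (hh : Homog0 φ) (hs : SmoothFn φ) (hx : ‖x‖ = 1)
    (he : OrthoFrame x e) (hμ : ∀ i j, secondDeriv φ x (e i) (e j) = if i = j then μ i else 0) :
    hessDefect φ x = n * ∑ i, (μ i + metricCoeff φ x) ^ 2 - (∑ i, (μ i + metricCoeff φ x)) ^ 2 := by
  have hx0 := ne_zero_of_norm_eq_one hx
  have h1 : ∀ v, secondDeriv φ x x v = -fderiv ℝ φ x v := fun v => by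
    rw [hs.secondDeriv_symm hx0, hh.secondDeriv_self_right hs hx0]
  have h2 := hh.secondDeriv_self_right hs hx0
  have t1 : ∑ i, ∑ j, secondDeriv φ x (EuclideanSpace.basisFun (Fin (n + 1)) ℝ i)
      (EuclideanSpace.basisFun (Fin (n + 1)) ℝ j) ^ 2 = ∑ i, μ i ^ 2 + 2 * ‖gradient φ x‖ ^ 2 := by
    rw [sum_sum_sq_apply_eq (hs.secondDeriv_symm hx0) _ (he.basis hx), he.coe_basis hx]
    simp only [Fin.sum_univ_succ, Fin.cons_zero, Fin.cons_succ, h1, h2, hμ, hh.fderiv_self hs,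
      sum_add_distrib, hh.norm_gradient_sq hs hx he, neg_sq, ite_pow, zero_pow two_ne_zero,
      sum_ite_eq, mem_univ, if_true]
    ring
  have t2 : ∑ i, secondDeriv φ x (EuclideanSpace.basisFun (Fin (n + 1)) ℝ i)
      (EuclideanSpace.basisFun (Fin (n + 1)) ℝ i) = ∑ i, μ i := by
    rw [sum_apply_self_eq _ _ (he.basis hx), he.coe_basis hx]
    simp [Fin.sum_univ_succ, h1, hμ, hh.fderiv_self hs]
  rw [hessDefect, t1, t2]
  simp only [add_sq, sum_add_distrib, ← sum_mul, ← mul_sum, sum_const, card_univ,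
    Fintype.card_fin, nsmul_eq_mul]
  ring

lemma Homog0.sum_esum_mul_thirdDeriv (hh : Homog0 φ) (hs : SmoothFn φ)
    (hpos : ∀ x ∈ uSphere n, 0 < φ x) (hsol : SolvesCM n (m + 1) p (fun _ => c) φ) (hx : ‖x‖ = 1)
    (he : OrthoFrame x e)
    (hμ : ∀ i j, secondDeriv φ x (e i) (e j) = if i = j then μ i else 0) :
    ∑ i, esum (fun i => μ i + metricCoeff φ x) m (univ.erase i)
        * thirdDeriv φ x (e i) (e i) (gradient φ x)
      = (p - (m + 1)) * esum (fun i => μ i + metricCoeff φ x) (m + 1) univ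
          * ‖gradient φ x‖ ^ 2 / φ x
        - (∑ i, esum (fun i => μ i + metricCoeff φ x) m (univ.erase i))
          * ∑ i, fderiv ℝ φ x (e i) ^ 2 * (1 - (μ i + metricCoeff φ x) / φ x)
        - 2 * ∑ i, esum (fun i => μ i + metricCoeff φ x) m (univ.erase i)
          * fderiv ℝ φ x (e i) ^ 2 := by
  have hx0 := ne_zero_of_norm_eq_one hx
  have ha := hpos x (mem_uSphere.2 hx)
  rw [hh.esum_eq hs hsol hx he hμ]
  have key := hh.sum_esum_mul_eq hs hpos hsol hx he hμ
  set S : Fin n → ℝ := fun i => esum (fun i => μ i + metricCoeff φ x) m (univ.erase i) with hS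
  have hthird : ∀ i, thirdDeriv φ x (e i) (e i) (gradient φ x)
      = ∑ l, fderiv ℝ φ x (e l) * thirdDeriv φ x (e l) (e i) (e i) := fun i => by
    conv_lhs => rw [thirdDeriv, hh.gradient_eq_sum hs hx he, map_sum]
    refine sum_congr rfl fun l _ => ?_
    rw [map_smul, smul_eq_mul]
    congr 1
    change thirdDeriv φ x (e i) (e i) (e l) = _
    rw [hs.thirdDeriv_symm_right hx0, hs.thirdDeriv_symm_left hx0]
  have hcoef : ∀ l, fderiv ℝ φ x (e l) * (1 + (φ x ^ 2)⁻¹ + ‖gradient φ x‖ ^ 2 / φ x ^ 2) / 2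
      - secondDeriv φ x (e l) (gradient φ x) / φ x
      = fderiv ℝ φ x (e l) * (1 - (μ l + metricCoeff φ x) / φ x) := fun l => by
    rw [hh.secondDeriv_gradient hs hx he hμ, metricCoeff]
    field_simp
    ring
  simp only [hcoef] at key
  have hl : ∀ l, ∑ i, S i * thirdDeriv φ x (e l) (e i) (e i)
      = c * ((p - (m + 1)) * φ x ^ (p - (m + 1)) * fderiv ℝ φ x (e l) / φ x)
        - 2 * S l * fderiv ℝ φ x (e l)
        - (∑ i, S i) * (fderiv ℝ φ x (e l) * (1 - (μ l + metricCoeff φ x) / φ x)) := fun l => by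
    rw [← key l]
    simp only [mul_add, sum_add_distrib, mul_ite, mul_zero, sum_ite_eq', mem_univ, if_true,
      ← sum_mul]
    ring
  calc ∑ i, S i * thirdDeriv φ x (e i) (e i) (gradient φ x)
      = ∑ l, fderiv ℝ φ x (e l) * ∑ i, S i * thirdDeriv φ x (e l) (e i) (e i) := by
        simp only [hthird, mul_sum]
        rw [sum_comm]
        exact sum_congr rfl fun _ _ => sum_congr rfl fun _ _ => by ring
    _ = _ := by
        generalize ∑ i, S i = T at hl
        simp only [hl, hh.norm_gradient_sq hs hx he, mul_sum, sum_div, ← sum_sub_distrib]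
        push_cast
        exact sum_congr rfl fun l _ => by ring

end Eigenframe

section Continuity

variable {n : ℕ} {φ : Euc n → ℝ}

lemma isCompact_uSphere : IsCompact (uSphere n) := isCompact_sphere _ _

lemma uSphere_subset : uSphere n ⊆ {y : Euc n | y ≠ 0} :=
  fun _ hy => ne_zero_of_norm_eq_one (mem_uSphere.1 hy)

lemma SmoothFn.continuousOn (hs : SmoothFn φ) : ContinuousOn φ (uSphere n) :=
  (ContDiffOn.continuousOn hs).mono uSphere_subset

lemma SmoothFn.continuousOn_fderiv (hs : SmoothFn φ) : ContinuousOn (fderiv ℝ φ) (uSphere n) :=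
  hs.contDiffOn_fderiv.continuousOn.mono uSphere_subset

lemma SmoothFn.continuousOn_secondDeriv (hs : SmoothFn φ) :
    ContinuousOn (secondDeriv φ) (uSphere n) :=
  hs.contDiffOn_secondDeriv.continuousOn.mono uSphere_subset

lemma norm_gradient (y : Euc n) : ‖gradient φ y‖ = ‖fderiv ℝ φ y‖ := by
  simp [gradient]

lemma SmoothFn.continuousOn_norm_gradient_sq (hs : SmoothFn φ) :
    ContinuousOn (fun y => ‖gradient φ y‖ ^ 2) (uSphere n) := by
  simp only [norm_gradient]
  exact hs.continuousOn_fderiv.norm.pow 2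

lemma SmoothFn.continuousOn_metricCoeff (hs : SmoothFn φ) (hpos : ∀ x ∈ uSphere n, 0 < φ x) :
    ContinuousOn (metricCoeff φ) (uSphere n) := by
  have h0 : ∀ x ∈ uSphere n, φ x ≠ 0 := fun x hx => (hpos x hx).ne'
  have h1 := hs.continuousOn
  exact ((h1.sub (h1.inv₀ h0)).div_const 2).sub
    (hs.continuousOn_norm_gradient_sq.div (h1.const_mul 2)
      fun x hx => mul_ne_zero two_ne_zero (h0 x hx))

lemma SmoothFn.continuousOn_hessDefect (hs : SmoothFn φ) :
    ContinuousOn (hessDefect φ) (uSphere n) := by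
  have h2 : ∀ v w, ContinuousOn (fun y => secondDeriv φ y v w) (uSphere n) := fun v w =>
    (hs.continuousOn_secondDeriv.clm_apply continuousOn_const).clm_apply continuousOn_const
  refine (continuousOn_const.mul (ContinuousOn.sub ?_
    (hs.continuousOn_norm_gradient_sq.const_mul 2))).sub (ContinuousOn.pow ?_ 2)
  · exact continuousOn_finsetSum _ fun i _ => continuousOn_finsetSum _ fun j _ => (h2 _ _).pow 2
  · exact continuousOn_finsetSum _ fun i _ => h2 _ _

lemma EvenFn.norm_gradient_neg (hs : SmoothFn φ) (he : EvenFn φ) {y : Euc n} (hy : y ≠ 0) :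
    ‖gradient φ (-y)‖ = ‖gradient φ y‖ := by
  rw [norm_gradient, norm_gradient, he.fderiv_neg hs hy, norm_neg]

lemma EvenFn.hessDefect_neg (hs : SmoothFn φ) (he : EvenFn φ) {y : Euc n} (hy : y ≠ 0) :
    hessDefect φ (-y) = hessDefect φ y := by
  simp only [hessDefect, he.secondDeriv_neg hs hy, he.norm_gradient_neg hs hy]

lemma SmoothFn.continuousOn_testFn (hs : SmoothFn φ) (hpos : ∀ x ∈ uSphere n, 0 < φ x)
    {G G' : ℝ → ℝ} (hG : ∀ a, 0 < a → HasDerivAt G (G' a) a) :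
    ContinuousOn (testFn G φ) (uSphere n) := by
  have h0 : ∀ x ∈ uSphere n, φ x ≠ 0 := fun x hx => (hpos x hx).ne'
  have h1 := hs.continuousOn
  refine ((hs.continuousOn_norm_gradient_sq.div (h1.const_mul 2)
      fun x hx => mul_ne_zero two_ne_zero (h0 x hx)).add
        ((h1.add (h1.inv₀ h0)).div_const 2)).add ?_
  exact ContinuousOn.comp (t := Set.Ioi 0)
    (fun a ha => (hG a ha).continuousAt.continuousWithinAt) h1 hpos

lemma Homog0.exists_le_aform (hh : Homog0 φ) (hs : SmoothFn φ)
    (hpos : ∀ x ∈ uSphere n, 0 < φ x) (hc : UnifHConvex φ) :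
    ∃ b, 0 < b ∧ ∀ x v : Euc n, ‖x‖ = 1 → ‖v‖ = 1 → ⟪x, v⟫ = 0 → b ≤ Aform φ x v v := by
  set K : Set (Euc n × Euc n) := (uSphere n ×ˢ uSphere n) ∩ {z | ⟪z.1, z.2⟫ = 0} with hK
  have hKc : IsCompact K := (isCompact_uSphere.prod isCompact_uSphere).inter_right
    (isClosed_eq (continuous_fst.inner continuous_snd) continuous_const)
  have hmaps : Set.MapsTo Prod.fst K (uSphere n) := fun z hz => hz.1.1
  have hcont : ContinuousOn (fun z : Euc n × Euc n =>
      secondDeriv φ z.1 z.2 z.2 + metricCoeff φ z.1) K := by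
    refine ContinuousOn.add (ContinuousOn.clm_apply (ContinuousOn.clm_apply ?_
      continuous_snd.continuousOn) continuous_snd.continuousOn) ?_
    · exact hs.continuousOn_secondDeriv.comp continuous_fst.continuousOn hmaps
    · exact (hs.continuousOn_metricCoeff hpos).comp continuous_fst.continuousOn hmaps
  have hval : ∀ x v : Euc n, ‖x‖ = 1 → ‖v‖ = 1 → ⟪x, v⟫ = 0 →
      Aform φ x v v = secondDeriv φ x v v + metricCoeff φ x := fun x v hx hv hxv => by
    rw [hh.aform_eq hs hx hxv hxv, real_inner_self_eq_norm_sq, hv, one_pow, mul_one]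
  rcases K.eq_empty_or_nonempty with h | h
  · refine ⟨1, one_pos, fun x v hx hv hxv => ?_⟩
    have : (x, v) ∈ K := ⟨⟨mem_uSphere.2 hx, mem_uSphere.2 hv⟩, hxv⟩
    simp [h] at this
  · obtain ⟨⟨x₀, v₀⟩, h₀, hmin⟩ := hKc.exists_isMinOn h hcont
    have hx₀ := mem_uSphere.1 h₀.1.1
    have hv₀ := mem_uSphere.1 h₀.1.2
    refine ⟨_, hc x₀ h₀.1.1 v₀ h₀.2 (ne_zero_of_norm_eq_one hv₀), fun x v hx hv hxv => ?_⟩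
    rw [hval x₀ v₀ hx₀ hv₀ h₀.2, hval x v hx hv hxv]
    exact hmin (show (x, v) ∈ K from ⟨⟨mem_uSphere.2 hx, mem_uSphere.2 hv⟩, hxv⟩)

lemma exists_hasDerivAt_rpow (c r : ℝ) :
    ∃ G : ℝ → ℝ, ∀ a, 0 < a → HasDerivAt G (c * a ^ r) a := by
  by_cases hr : r = -1
  · refine ⟨fun a => c * Real.log a, fun a ha => ?_⟩
    rw [hr, Real.rpow_neg_one]
    exact (Real.hasDerivAt_log ha.ne').const_mul c
  · have hr' : r + 1 ≠ 0 := fun h => hr (by linarith)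
    refine ⟨fun a => c * (a ^ (r + 1) / (r + 1)), fun a ha => ?_⟩
    have := ((Real.hasDerivAt_rpow_const (p := r + 1) (Or.inl ha.ne')).div_const
      (r + 1)).const_mul c
    refine this.congr_deriv ?_
    rw [add_sub_cancel_right]
    field_simp

/-- An even continuous function which is positive at a unit vector `y` stays close to its value
there on a double cap around `y`. -/
lemma exists_forall_half_lt {W : Euc n → ℝ} (hW : ContinuousOn W (uSphere n))
    (hev : ∀ x ∈ uSphere n, W (-x) = W x) {y : Euc n} (hy : ‖y‖ = 1) (hWy : 0 < W y) :
    ∃ η, 0 < η ∧ ∀ x, ‖x‖ = 1 → 1 - η < ⟪y, x⟫ ^ 2 → W y / 2 < W x := by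
  have hy' := mem_uSphere.2 hy
  obtain ⟨δ, hδ, h⟩ := Metric.continuousWithinAt_iff.1 (hW y hy') (W y / 2) (by linarith)
  have key : ∀ x, ‖x‖ = 1 → 0 ≤ ⟪y, x⟫ → 1 - δ ^ 2 / 2 < ⟪y, x⟫ ^ 2 → W y / 2 < W x :=
    fun x hx h0 h1 => by
      have hle : ⟪y, x⟫ ≤ 1 := by simpa [hx, hy] using real_inner_le_norm y x
      have hd : dist x y < δ := by
        rw [dist_eq_norm, norm_sub_rev]
        have := norm_sub_sq_real y x
        rw [hx, hy] at this
        refine lt_of_pow_lt_pow_left₀ 2 hδ.le ?_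
        nlinarith
      have := h (mem_uSphere.2 hx) hd
      rw [Real.dist_eq, abs_lt] at this
      linarith
  refine ⟨δ ^ 2 / 2, by positivity, fun x hx h1 => ?_⟩
  rcases le_total 0 ⟪y, x⟫ with h0 | h0
  · exact key x hx h0 h1
  · rw [← hev x (mem_uSphere.2 hx)]
    exact key (-x) (by simpa using hx) (by simpa [inner_neg_right] using h0)
      (by simpa [inner_neg_right] using h1)

end Continuity

section Defect

variable {n m : ℕ} {φ : Euc n → ℝ} {p γ : ℝ}

/-- A weighted sum of the deviation of `A[φ]` from a multiple of the metric and of the squared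
norm of the gradient. -/
def defectSum {n : ℕ} (m : ℕ) (b q : ℝ) (φ : Euc n → ℝ) (y : Euc n) : ℝ :=
  b ^ m / (n * φ y) * hessDefect φ y + q * b ^ (m + 1) / φ y ^ 2 * ‖gradient φ y‖ ^ 2

lemma Homog0.hessDefect_nonneg (hh : Homog0 φ) (hs : SmoothFn φ) {x : Euc n} (hx : ‖x‖ = 1) :
    0 ≤ hessDefect φ x := by
  obtain ⟨e, μ, he, hμ⟩ := exists_eigenframe (hs.secondDeriv_symm (ne_zero_of_norm_eq_one hx)) hx
  rw [hh.hessDefect_eq hs hx he hμ, sub_nonneg]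
  simpa using sq_sum_le_card_mul_sum_sq (s := univ) (f := fun i => μ i + metricCoeff φ x)

lemma Homog0.defectSum_le (hh : Homog0 φ) (hs : SmoothFn φ) (hm : m + 2 ≤ n)
    (hone : ∀ x ∈ uSphere n, 1 < φ x) {q c b Λ L : ℝ} (hq0 : 0 ≤ q) (hq : p = q * (m + 1))
    (hc : 0 < c) (hcγ : (n.choose (m + 1) : ℝ) * c ^ (m + 1) = γ)
    (hsol : SolvesCM n (m + 1) p (fun _ => γ) φ) (hb0 : 0 < b)
    (hb : ∀ x v : Euc n, ‖x‖ = 1 → ‖v‖ = 1 → ⟪x, v⟫ = 0 → b ≤ Aform φ x v v)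
    (hΛ : ∀ x ∈ uSphere n, ‖secondDeriv φ x‖ + metricCoeff φ x ≤ Λ)
    (hL : ∀ x ∈ uSphere n, ‖fderiv ℝ φ x‖ ≤ L) {G : ℝ → ℝ}
    (hG : ∀ a, 0 < a → HasDerivAt G (-c * a ^ (q - 2)) a) {z x : Euc n} {ε α : ℝ} (hε : 0 ≤ ε)
    (hα : 0 ≤ α) (hz : ‖z‖ = 1) (hx : ‖x‖ = 1)
    (hmax : ∀ y, ‖y‖ = 1 → testFn G φ y + ε * Real.exp (α * ⟪z, y⟫)
      ≤ testFn G φ x + ε * Real.exp (α * ⟪z, x⟫)) :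
    defectSum m b q φ x ≤ ε * Real.exp (α * ⟪z, x⟫) * α
      * (n * (L * ((3 + q) * (n * ((n - 1).choose m * Λ ^ m))))
        + n * ((n - 1).choose m * Λ ^ m) - α * b ^ m * (1 - ⟪z, x⟫ ^ 2)) := by
  have hx' := mem_uSphere.2 hx
  have hpos : ∀ x ∈ uSphere n, 0 < φ x := fun x hx => one_pos.trans (hone x hx)
  have ha := hpos x hx'
  have ha1 := hone x hx'
  obtain ⟨e, μ, he, hμ⟩ := exists_eigenframe (hs.secondDeriv_symm (ne_zero_of_norm_eq_one hx)) hx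
  have hlb : ∀ i, b ≤ μ i + metricCoeff φ x := fun i => by
    have := hb x (e i) hx (he.norm_eq_one i) (he.1 i)
    rwa [hh.aform_eigenframe hs hx he hμ, if_pos rfl] at this
  have hlΛ : ∀ i, μ i + metricCoeff φ x ≤ Λ := fun i => by
    refine le_trans (add_le_add_left ?_ _) (hΛ x hx')
    have h1 := (secondDeriv φ x).le_opNorm₂ (e i) (e i)
    rw [hμ, if_pos rfl, he.norm_eq_one, mul_one, mul_one] at h1
    exact (le_abs_self _).trans h1
  have hcard : ∀ i : Fin n, (univ.erase i).card = n - 1 := fun i => by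
    rw [card_erase_of_mem (mem_univ i), card_univ, Fintype.card_fin]
  have hfd : 0 < c * φ x ^ (q - 1) := mul_pos hc (Real.rpow_pos_of_pos ha _)
  have hf1 : -c * φ x ^ (q - 2) = -(c * φ x ^ (q - 1) / φ x) := by
    rw [show q - 2 = q - 1 - 1 by ring, Real.rpow_sub_one ha.ne']
    ring
  have hG2 : HasDerivAt (fun a => -c * a ^ (q - 2))
      (-((q - 2) * (c * φ x ^ (q - 1)) / φ x ^ 2)) (φ x) := by
    refine ((Real.hasDerivAt_rpow_const (p := q - 2) (Or.inl ha.ne')).const_mul (-c)).congr_deriv ?_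
    rw [show q - 2 - 1 = q - 1 - 1 - 1 by ring, Real.rpow_sub_one ha.ne', Real.rpow_sub_one ha.ne']
    ring
  have hcond := fun i => hh.max_conditions hs hpos hG hx hG2 (he.norm_eq_one i) (he.1 i)
    hmax ((hμ i i).trans (if_pos rfl)) (hh.secondDeriv_gradient hs hx he hμ i)
    (hh.norm_rieszVec_secondDeriv_sq hs hx he hμ i)
  have hF : esum (fun i => μ i + metricCoeff φ x) (m + 1) univ
      = (n.choose (m + 1) : ℝ) * (c * φ x ^ (q - 1)) ^ (m + 1) := by
    rw [hh.esum_eq hs hsol hx he hμ, mul_pow, ← mul_assoc, hcγ, mul_comm,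
      ← Real.rpow_mul_natCast ha.le, hq]
    push_cast
    ring_nf
  have hu : 0 ≤ metricCoeff φ x + ‖gradient φ x‖ ^ 2 / φ x := by
    have : metricCoeff φ x + ‖gradient φ x‖ ^ 2 / φ x
        = (‖gradient φ x‖ ^ 2 + (φ x ^ 2 - 1)) / (2 * φ x) := by
      rw [metricCoeff]; field_simp; ring
    rw [this]
    have : 0 ≤ φ x ^ 2 - 1 := by nlinarith
    positivity
  have h1 := le_of_max_conditions (τ := fun i => thirdDeriv φ x (e i) (e i) (gradient φ x))
    hm ha hb0 hlb hfd hq0 hq (hh.norm_gradient_sq hs hx he) hu hF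
    (hh.sum_esum_mul_thirdDeriv hs hpos hsol hx he hμ)
    (P := fun i => ε * Real.exp (α * ⟪z, x⟫) * (α * ⟪z, e i⟫))
    (Q := fun i => ε * Real.exp (α * ⟪z, x⟫) * (α ^ 2 * ⟪z, e i⟫ ^ 2 - α * ⟪z, x⟫))
    (fun i => by have := (hcond i).1; rwa [hf1] at this)
    (fun i => by have := (hcond i).2; rw [hf1] at this; simpa using this)
  have h2 := rhs_le (n := n) (a := φ x) (q := q) (v := fun i => fderiv ℝ φ x (e i)) (L := L)
    (ρ := ⟪z, x⟫) (ψ := ε * Real.exp (α * ⟪z, x⟫)) (α := α) (w := fun i => ⟪z, e i⟫)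
    (S := fun i => esum (fun i => μ i + metricCoeff φ x) m (univ.erase i)) (b := b ^ m)
    (T := n * ((n - 1).choose m * Λ ^ m)) ha1.le hq0
    (mul_nonneg hε (Real.exp_pos _).le) hα
    (fun i => pow_le_esum hb0.le (fun j _ => hlb j) (by rw [hcard]; omega)) (by positivity)
    (by
      refine (sum_le_sum fun i _ => esum_le (fun j _ => hb0.le.trans (hlb j))
        (fun j _ => hlΛ j) m).trans ?_
      simp [hcard])
    (fun i => by
      have := (fderiv ℝ φ x).le_opNorm (e i)
      rw [he.norm_eq_one, mul_one] at this
      exact this.trans (hL x hx'))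
    (by
      have := he.sum_sq_inner hx z
      rw [hz, one_pow] at this
      rw [← this, real_inner_comm]
      simp only [real_inner_comm z])
  rw [defectSum, hh.hessDefect_eq hs hx he hμ]
  exact h1.trans h2

end Defect

section Umbilic

variable {n m : ℕ} {φ : Euc n → ℝ} {p q c γ : ℝ}

lemma Homog0.exists_defectSum_eq_zero (hh : Homog0 φ) (hs : SmoothFn φ) (hev : EvenFn φ)
    (hm : m + 2 ≤ n) (hone : ∀ x ∈ uSphere n, 1 < φ x) (hconv : UnifHConvex φ) (hq0 : 0 ≤ q)
    (hq : p = q * (m + 1)) (hc : 0 < c) (hcγ : (n.choose (m + 1) : ℝ) * c ^ (m + 1) = γ)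
    (hsol : SolvesCM n (m + 1) p (fun _ => γ) φ) :
    ∃ b, 0 < b ∧ ∀ y, ‖y‖ = 1 → defectSum m b q φ y = 0 := by
  have hpos : ∀ x ∈ uSphere n, 0 < φ x := fun x hx => one_pos.trans (hone x hx)
  have hn : (0 : ℝ) < n := by exact_mod_cast (by omega : 0 < n)
  obtain ⟨b, hb0, hb⟩ := hh.exists_le_aform hs hpos hconv
  have hnorm : ContinuousOn (fun x => ‖secondDeriv φ x‖) (uSphere n) :=
    ContinuousOn.norm (E := Euc n →L[ℝ] Euc n →L[ℝ] ℝ) hs.continuousOn_secondDeriv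
  obtain ⟨Λ, hΛ⟩ := isCompact_uSphere.bddAbove_image
    (hnorm.add (hs.continuousOn_metricCoeff hpos))
  obtain ⟨L, hL⟩ := isCompact_uSphere.bddAbove_image hs.continuousOn_fderiv.norm
  obtain ⟨G, hG⟩ := exists_hasDerivAt_rpow (-c) (q - 2)
  have hnn : ∀ x ∈ uSphere n, 0 ≤ defectSum m b q φ x := fun x hx => by
    have h1 := hh.hessDefect_nonneg hs (mem_uSphere.1 hx)
    have h2 := hpos x hx
    rw [defectSum]
    positivity
  have hcont : ContinuousOn (defectSum m b q φ) (uSphere n) := by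
    have h1 := hs.continuousOn
    refine ((continuousOn_const.div (h1.const_mul _) fun x hx => ?_).mul
      hs.continuousOn_hessDefect).add ((continuousOn_const.div (h1.pow 2) fun x hx => ?_).mul
        hs.continuousOn_norm_gradient_sq)
    · exact (mul_pos hn (hpos x hx)).ne'
    · exact (pow_pos (hpos x hx) 2).ne'
  have hneg : ∀ x ∈ uSphere n, defectSum m b q φ (-x) = defectSum m b q φ x := fun x hx => by
    simp only [defectSum, hev.hessDefect_neg hs (uSphere_subset hx),
      hev.norm_gradient_neg hs (uSphere_subset hx), hev x]
  refine ⟨b, hb0, fun y hy => ?_⟩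
  by_contra hne
  have hWy := lt_of_le_of_ne (hnn y (mem_uSphere.2 hy)) (Ne.symm hne)
  obtain ⟨η, hη, hcap⟩ := exists_forall_half_lt hcont hneg hy hWy
  set T := n * ((n - 1).choose m * Λ ^ m) with hT
  set M := n * (L * ((3 + q) * T)) + T with hM
  set α := (|M| + 1) / (b ^ m * η) with hα
  have hα0 : 0 < α := by positivity
  set ε := defectSum m b q φ y / (2 * Real.exp α * α * (|M| + 1)) with hε
  have hε0 : 0 < ε := by positivity
  obtain ⟨x, hx', hmax⟩ := isCompact_uSphere.exists_isMaxOn ⟨y, mem_uSphere.2 hy⟩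
    ((hs.continuousOn_testFn hpos hG).add (f := testFn G φ)
      (g := fun x => ε * Real.exp (α * ⟪y, x⟫)) (by fun_prop))
  have hx := mem_uSphere.1 hx'
  have hle := hh.defectSum_le hs hm hone hq0 hq hc hcγ hsol hb0 hb
    (fun x hx => hΛ (Set.mem_image_of_mem _ hx)) (fun x hx => hL (Set.mem_image_of_mem _ hx)) hG
    hε0.le hα0.le hy hx (fun y hy => hmax (mem_uSphere.2 hy))
  rw [← hT, ← hM] at hle
  have hαη : α * b ^ m * η = |M| + 1 := by rw [hα]; field_simp
  have hexp : Real.exp (α * ⟪y, x⟫) ≤ Real.exp α := by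
    have : ⟪y, x⟫ ≤ 1 := by simpa [hx, hy] using real_inner_le_norm y x
    exact Real.exp_le_exp.2 (by nlinarith)
  have hρ : ⟪y, x⟫ ^ 2 ≤ 1 := by
    have := abs_real_inner_le_norm y x
    rw [hx, hy, mul_one] at this
    exact (sq_le_one_iff_abs_le_one _).2 this
  have hexp0 := Real.exp_pos (α * ⟪y, x⟫)
  have hbm : 0 < b ^ m := pow_pos hb0 m
  by_cases hcase : 1 - η < ⟪y, x⟫ ^ 2
  · have h1 := hcap x hx hcase
    have h2 : ε * Real.exp (α * ⟪y, x⟫) * α * (M - α * b ^ m * (1 - ⟪y, x⟫ ^ 2))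
        ≤ ε * Real.exp α * α * (|M| + 1) := by
      have : M - α * b ^ m * (1 - ⟪y, x⟫ ^ 2) ≤ |M| + 1 := by
        have := mul_nonneg (mul_pos hα0 hbm).le (sub_nonneg.2 hρ)
        linarith [le_abs_self M]
      calc _ ≤ ε * Real.exp (α * ⟪y, x⟫) * α * (|M| + 1) :=
            mul_le_mul_of_nonneg_left this (by positivity)
        _ ≤ _ := by gcongr
    have h3 : ε * Real.exp α * α * (|M| + 1) = defectSum m b q φ y / 2 := by
      rw [hε]; field_simp
    linarith
  · have h1 := hnn x hx'
    have h2 : M - α * b ^ m * (1 - ⟪y, x⟫ ^ 2) < 0 := by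
      have := mul_le_mul_of_nonneg_left (by linarith : η ≤ 1 - ⟪y, x⟫ ^ 2) (mul_pos hα0 hbm).le
      linarith [le_abs_self M]
    have := mul_neg_of_pos_of_neg (by positivity : 0 < ε * Real.exp (α * ⟪y, x⟫) * α) h2
    linarith

lemma Homog0.secondDeriv_eq_of_hessDefect_eq_zero (hh : Homog0 φ) (hs : SmoothFn φ)
    (hm : m + 2 ≤ n) (hpos : ∀ x ∈ uSphere n, 0 < φ x) (hconv : UnifHConvex φ)
    (hq : p = q * (m + 1)) (hc : 0 < c) (hcγ : (n.choose (m + 1) : ℝ) * c ^ (m + 1) = γ)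
    (hsol : SolvesCM n (m + 1) p (fun _ => γ) φ) {x : Euc n} (hx : ‖x‖ = 1)
    (h0 : hessDefect φ x = 0) {v w : Euc n} (hv : ⟪x, v⟫ = 0) (hw : ⟪x, w⟫ = 0) :
    secondDeriv φ x v w = (c * φ x ^ (q - 1) - metricCoeff φ x) * ⟪v, w⟫ := by
  have hx' := mem_uSphere.2 hx
  have ha := hpos x hx'
  obtain ⟨e, μ, he, hμ⟩ := exists_eigenframe (hs.secondDeriv_symm (ne_zero_of_norm_eq_one hx)) hx
  have hl0 : ∀ i, 0 < μ i + metricCoeff φ x := fun i => by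
    have := hconv x hx' (e i) (he.1 i) (ne_zero_of_norm_eq_one (he.norm_eq_one i))
    rwa [hh.aform_eigenframe hs hx he hμ, if_pos rfl] at this
  have heq : ∀ i j, μ i + metricCoeff φ x = μ j + metricCoeff φ x := fun i j => by
    rw [hh.hessDefect_eq hs hx he hμ] at h0
    have h1 := sum_sum_sub_mul_sub (univ : Finset (Fin n)) (fun i => μ i + metricCoeff φ x)
      (fun i => μ i + metricCoeff φ x)
    simp only [← sq, card_univ, Fintype.card_fin] at h1
    rw [h0, mul_zero, sum_eq_zero_iff_of_nonneg
      fun i _ => sum_nonneg fun j _ => sq_nonneg _] at h1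
    have h2 := (sum_eq_zero_iff_of_nonneg fun j _ => sq_nonneg _).1 (h1 i (mem_univ i)) j
      (mem_univ j)
    exact sub_eq_zero.1 (pow_eq_zero_iff two_ne_zero |>.1 h2)
  have hval : ∀ i, μ i = c * φ x ^ (q - 1) - metricCoeff φ x := fun i => by
    have h1 := hh.esum_eq hs hsol hx he hμ
    rw [show (fun i => μ i + metricCoeff φ x) = fun _ => μ i + metricCoeff φ x from
      funext fun j => heq j i, esum_const, card_univ, Fintype.card_fin, ← hcγ] at h1
    have hC : (0 : ℝ) < n.choose (m + 1) := by exact_mod_cast Nat.choose_pos (by omega)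
    have h2 : (μ i + metricCoeff φ x) ^ (m + 1) = (c * φ x ^ (q - 1)) ^ (m + 1) := by
      refine mul_left_cancel₀ hC.ne' (h1.trans ?_)
      rw [mul_pow, ← Real.rpow_mul_natCast ha.le, hq]
      push_cast
      ring_nf
    have h3 := (pow_left_inj₀ (hl0 i).le (by positivity) m.succ_ne_zero).1 h2
    linarith
  rw [← he.sum_inner_smul hx hv]
  simp only [map_sum, sum_inner, _root_.sum_apply, map_smul, real_inner_smul_left,
    _root_.smul_apply, smul_eq_mul, mul_sum]
  refine sum_congr rfl fun i _ => ?_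
  conv_lhs => rw [← he.sum_inner_smul hx hw]
  simp only [map_sum, map_smul, hμ, smul_eq_mul, mul_ite, mul_zero, sum_ite_eq, mem_univ, if_true,
    hval]
  ring

/-- If the Hessian of an even function vanishes, then so does its gradient. -/
lemma Homog0.fderiv_eq_zero_of_secondDeriv_eq_zero (hh : Homog0 φ) (hs : SmoothFn φ)
    (hev : EvenFn φ) (h : ∀ x e : Euc n, ‖x‖ = 1 → ‖e‖ = 1 → ⟪x, e⟫ = 0 → secondDeriv φ x e e = 0)
    {x e : Euc n} (hx : ‖x‖ = 1) (he : ‖e‖ = 1) (hxe : ⟪x, e⟫ = 0) : fderiv ℝ φ x e = 0 := by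
  have h1 := hh.hasDerivAt_deriv_greatCircle hs hx he hxe
  have hconst : ∀ t, fderiv ℝ φ (greatCircle x e t) (greatCircle e (-x) t) = fderiv ℝ φ x e :=
    fun t => by
      have := is_const_of_deriv_eq_zero (fun t => (h1 t).differentiableAt) (fun t => by
        obtain ⟨a1, a2, a3⟩ := inner_greatCircle hx he hxe t
        rw [(h1 t).deriv, h _ _ a1 a2 a3]) t 0
      simpa [greatCircle_zero] using this
  have h2 : ∀ t, HasDerivAt (fun s => φ (greatCircle x e s) - fderiv ℝ φ x e * s) 0 t := fun t => by
    refine ((hs.hasDerivAt_greatCircle hx he hxe t).sub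
      ((hasDerivAt_id t).const_mul (fderiv ℝ φ x e))).congr_deriv ?_
    rw [hconst t, mul_one, sub_self]
  have h3 := is_const_of_deriv_eq_zero (fun t => (h2 t).differentiableAt)
    (fun t => (h2 t).deriv) Real.pi 0
  simpa [greatCircle_zero, greatCircle_pi, hev x, Real.pi_ne_zero] using h3

lemma Homog0.secondDeriv_eq_zero_of_fderiv_eq_zero (hh : Homog0 φ) (hs : SmoothFn φ)
    (h : ∀ x, ‖x‖ = 1 → fderiv ℝ φ x = 0) {x e : Euc n} (hx : ‖x‖ = 1) (he : ‖e‖ = 1)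
    (hxe : ⟪x, e⟫ = 0) : secondDeriv φ x e e = 0 := by
  have h1 := hh.hasDerivAt_deriv_greatCircle hs hx he hxe 0
  have h2 : (fun s => fderiv ℝ φ (greatCircle x e s) (greatCircle e (-x) s)) = fun _ => 0 :=
    funext fun t => by simp [h _ (inner_greatCircle hx he hxe t).1]
  rw [h2] at h1
  simpa [greatCircle_zero] using h1.unique (hasDerivAt_const 0 0)

/-- If `D²φ + φ σ` is a constant multiple of the metric along great circles, with the constant of
the equation for `p = 0`, then the Hessian vanishes. -/
lemma Homog0.secondDeriv_eq_zero_of_umbilic (hh : Homog0 φ) (hs : SmoothFn φ) (hev : EvenFn φ)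
    (hpos : ∀ x ∈ uSphere n, 0 < φ x)
    (h : ∀ x v w : Euc n, ‖x‖ = 1 → ⟪x, v⟫ = 0 → ⟪x, w⟫ = 0 →
      secondDeriv φ x v w = (c / φ x - metricCoeff φ x) * ⟪v, w⟫) {x e : Euc n} (hx : ‖x‖ = 1)
    (he : ‖e‖ = 1) (hxe : ⟪x, e⟫ = 0) : secondDeriv φ x e e = 0 := by
  have hG : ∀ a : ℝ, 0 < a → HasDerivAt (fun a => c * a⁻¹) (c * -(a ^ 2)⁻¹) a := fun a ha =>
    (hasDerivAt_inv ha.ne').const_mul c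
  have hV : ∀ t, HasDerivAt (fun s => testFn (fun a => c * a⁻¹) φ (greatCircle x e s)) 0 t :=
    fun t => by
      obtain ⟨a1, a2, a3⟩ := inner_greatCircle hx he hxe t
      have ha := hpos _ (mem_uSphere.2 a1)
      refine (hs.hasDerivAt_testFn_comp hG (hasDerivAt_greatCircle t)
        (ne_zero_of_norm_eq_one a1) ha).congr_deriv ?_
      rw [h _ _ _ a1 a3 (hh.inner_gradient_self hs _), real_inner_comm, inner_gradient, metricCoeff]
      field_simp
      ring
  set V := testFn (fun a => c * a⁻¹) φ x with hVdef
  have hVc : ∀ t, testFn (fun a => c * a⁻¹) φ (greatCircle x e t) = V := fun t => by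
    have := is_const_of_deriv_eq_zero (fun t => (hV t).differentiableAt)
      (fun t => (hV t).deriv) t 0
    simpa [greatCircle_zero] using this
  have hμ : ∀ y ∈ uSphere n, c / φ y - metricCoeff φ y
      = testFn (fun a => c * a⁻¹) φ y - φ y := fun y hy => by
    have := hpos y hy
    rw [testFn, metricCoeff]
    ring
  have hd : ∀ t, HasDerivAt (fun s => fderiv ℝ φ (greatCircle x e s) (greatCircle e (-x) s)
      * Real.sin s - (φ (greatCircle x e s) - V) * Real.cos s) 0 t := fun t => by
    obtain ⟨a1, a2, a3⟩ := inner_greatCircle hx he hxe t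
    refine (((hh.hasDerivAt_deriv_greatCircle hs hx he hxe t).mul (Real.hasDerivAt_sin t)).sub
      (((hs.hasDerivAt_greatCircle hx he hxe t).sub_const V).mul
        (Real.hasDerivAt_cos t))).congr_deriv ?_
    rw [h _ _ _ a1 a3 a3, real_inner_self_eq_norm_sq, a2, hμ _ (mem_uSphere.2 a1), hVc]
    ring
  have := is_const_of_deriv_eq_zero (fun t => (hd t).differentiableAt)
    (fun t => (hd t).deriv) Real.pi 0
  simp only [greatCircle_zero, greatCircle_pi, Real.sin_pi, Real.cos_pi, Real.sin_zero,
    Real.cos_zero, hev x] at this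
  rw [h x e e hx hxe hxe, hμ x (mem_uSphere.2 hx), ← hVdef, show V - φ x = 0 by linarith, zero_mul]

lemma exists_unique_scalar_solution (hq0 : 0 ≤ q) (hq2 : q < 2) (hc : 0 < c) :
    ∃ a, 1 < a ∧ (a - a⁻¹) / 2 = c * a ^ (q - 1) ∧
      ∀ b, 1 < b → (b - b⁻¹) / 2 = c * b ^ (q - 1) → b = a := by
  set h : ℝ → ℝ := fun a => (a ^ (2 - q) - a ^ (-q)) / 2 with hh
  have hq : 0 < 2 - q := by linarith
  have heq : ∀ a : ℝ, 0 < a → ((a - a⁻¹) / 2 = c * a ^ (q - 1) ↔ h a = c) := fun a ha => by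
    have h1 : h a * a ^ (q - 1) = (a - a⁻¹) / 2 := by
      have e1 : a ^ (2 - q) * a ^ (q - 1) = a := by
        rw [← Real.rpow_add ha, show 2 - q + (q - 1) = 1 by ring, Real.rpow_one]
      have e2 : a ^ (-q) * a ^ (q - 1) = a⁻¹ := by
        rw [← Real.rpow_add ha, show -q + (q - 1) = -1 by ring, Real.rpow_neg_one]
      simp only [hh]
      linear_combination (e1 - e2) / 2
    rw [← h1, mul_left_inj' (Real.rpow_pos_of_pos ha _).ne']
  have hmono : StrictMonoOn h (Set.Ioi 0) := fun a ha b hb hab => by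
    have h1 := Real.rpow_lt_rpow (le_of_lt ha) hab hq
    have h2 := Real.rpow_le_rpow_of_nonpos ha hab.le (neg_nonpos.2 hq0)
    simp only [hh]
    linarith
  set X := (2 * c + 1) ^ (1 / (2 - q)) with hX
  have hX1 : 1 ≤ X := Real.one_le_rpow (by linarith) (by positivity)
  have hcont : ContinuousOn h (Set.Icc 1 X) := by
    have : ∀ r : ℝ, ContinuousOn (fun a : ℝ => a ^ r) (Set.Icc 1 X) := fun r =>
      continuousOn_id.rpow_const fun a ha => Or.inl (one_pos.trans_le ha.1).ne'
    exact ((this _).sub (this _)).div_const 2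
  have h1 : h 1 = 0 := by simp [hh]
  have hXv : c ≤ h X := by
    have e1 : X ^ (2 - q) = 2 * c + 1 := by
      rw [hX, ← Real.rpow_mul (by linarith), one_div_mul_cancel hq.ne', Real.rpow_one]
    have e2 : X ^ (-q) ≤ 1 := Real.rpow_le_one_of_one_le_of_nonpos hX1 (neg_nonpos.2 hq0)
    simp only [hh, e1]
    linarith
  obtain ⟨a, ha, hac⟩ := intermediate_value_Icc hX1 hcont ⟨h1.trans_le hc.le, hXv⟩
  have ha1 : 1 < a := lt_of_le_of_ne ha.1 fun h' => by rw [← h', h1] at hac; exact hc.ne hac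
  have ha0 := one_pos.trans ha1
  refine ⟨a, ha1, (heq a ha0).2 hac, fun b hb hbc => ?_⟩
  have hb0 := one_pos.trans hb
  exact hmono.injOn hb0 ha0 (((heq b hb0).1 hbc).trans hac.symm)

end Umbilic

section Constant

variable {n m : ℕ} {p q c γ : ℝ}

lemma aform_const {a : ℝ} {x v w : Euc n} (hx : ‖x‖ = 1) (hv : ⟪x, v⟫ = 0) (hw : ⟪x, w⟫ = 0) :
    Aform (fun _ => a) x v w = (a - a⁻¹) / 2 * ⟪v, w⟫ := by
  have hh : Homog0 (fun _ : Euc n => a) := fun _ _ _ => rfl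
  have hs : SmoothFn (fun _ : Euc n => a) := contDiffOn_const
  rw [hh.aform_eq hs hx hv hw]
  simp [secondDeriv, metricCoeff, gradient]

lemma unifHConvex_const {a : ℝ} (ha : 1 < a) : UnifHConvex (fun _ : Euc n => a) :=
  fun x hx v hv hv0 => by
    rw [aform_const (mem_uSphere.1 hx) hv hv, real_inner_self_eq_norm_sq]
    have h1 : a⁻¹ < 1 := inv_lt_one_of_one_lt₀ ha
    have h2 := norm_pos_iff.2 hv0
    exact mul_pos (by linarith) (pow_pos h2 2)

lemma sigmaMat_amat_const {a : ℝ} {x : Euc n} (hx : ‖x‖ = 1) {e : Fin n → Euc n}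
    (he : OrthoFrame x e) (k : ℕ) :
    sigmaMat k (Amat (fun _ => a) x e) = (n.choose k : ℝ) * ((a - a⁻¹) / 2) ^ k := by
  have := sigmaMat_of_diagonal (M := Amat (fun _ => a) x e) (l := fun _ => (a - a⁻¹) / 2)
    (fun i j => by
      rw [Amat, Matrix.of_apply, aform_const hx (he.1 i) (he.1 j), he.2]
      split_ifs <;> simp) k
  rw [this, esum_const, card_univ, Fintype.card_fin]

lemma Homog0.scalar_eq (hm : m + 2 ≤ n) (hq0 : 0 ≤ q) (hq : p = q * (m + 1)) (hc : 0 < c)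
    (hcγ : (n.choose (m + 1) : ℝ) * c ^ (m + 1) = γ) {φ : Euc n → ℝ} (hh : Homog0 φ)
    (hs : SmoothFn φ) (hev : EvenFn φ) (hone : ∀ x ∈ uSphere n, 1 < φ x) (hconv : UnifHConvex φ)
    (hsol : SolvesCM n (m + 1) p (fun _ => γ) φ) {x : Euc n} (hx : ‖x‖ = 1) :
    (φ x - (φ x)⁻¹) / 2 = c * φ x ^ (q - 1) := by
  have hpos : ∀ x ∈ uSphere n, 0 < φ x := fun x hx => one_pos.trans (hone x hx)
  obtain ⟨b, hb, h0⟩ := hh.exists_defectSum_eq_zero hs hev hm hone hconv hq0 hq hc hcγ hsol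
  have hn : (0 : ℝ) < n := by exact_mod_cast (by omega : 0 < n)
  have hsplit : ∀ y, ‖y‖ = 1 → hessDefect φ y = 0 ∧ (0 < q → ‖gradient φ y‖ = 0) := fun y hy => by
    have ha := hpos y (mem_uSphere.2 hy)
    have h1 := hh.hessDefect_nonneg hs hy
    have h2 := h0 y hy
    rw [defectSum, add_eq_zero_iff_of_nonneg (by positivity) (by positivity)] at h2
    refine ⟨(mul_eq_zero.1 h2.1).resolve_left (by positivity), fun hq' => ?_⟩
    exact pow_eq_zero_iff two_ne_zero |>.1 ((mul_eq_zero.1 h2.2).resolve_left (by positivity))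
  have hess : ∀ y v w : Euc n, ‖y‖ = 1 → ⟪y, v⟫ = 0 → ⟪y, w⟫ = 0 →
      secondDeriv φ y v w = (c * φ y ^ (q - 1) - metricCoeff φ y) * ⟪v, w⟫ :=
    fun y v w hy hv hw => hh.secondDeriv_eq_of_hessDefect_eq_zero hs hm hpos hconv hq hc hcγ hsol hy
      (hsplit y hy).1 hv hw
  have hzero : (∀ y e : Euc n, ‖y‖ = 1 → ‖e‖ = 1 → ⟪y, e⟫ = 0 → secondDeriv φ y e e = 0) ∧
      ‖gradient φ x‖ = 0 := by
    rcases hq0.eq_or_lt with hq' | hq'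
    · have h1 : ∀ y e : Euc n, ‖y‖ = 1 → ‖e‖ = 1 → ⟪y, e⟫ = 0 → secondDeriv φ y e e = 0 :=
        fun y e => hh.secondDeriv_eq_zero_of_umbilic hs hev hpos fun y v w hy hv hw => by
          rw [hess y v w hy hv hw, ← hq', zero_sub, Real.rpow_neg_one, div_eq_mul_inv]
      obtain ⟨e, -, he, -⟩ := exists_eigenframe (B := (0 : Euc n →L[ℝ] Euc n →L[ℝ] ℝ))
        (fun _ _ => rfl) hx
      refine ⟨h1, pow_eq_zero_iff two_ne_zero |>.1 ?_⟩
      rw [hh.norm_gradient_sq hs hx he]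
      refine sum_eq_zero fun i _ => ?_
      rw [hh.fderiv_eq_zero_of_secondDeriv_eq_zero hs hev h1 hx (he.norm_eq_one i) (he.1 i),
        zero_pow two_ne_zero]
    · refine ⟨fun y e hy he hye => hh.secondDeriv_eq_zero_of_fderiv_eq_zero hs (fun z hz => ?_)
        hy he hye, (hsplit x hx).2 hq'⟩
      rw [← norm_eq_zero, ← norm_gradient, (hsplit z hz).2 hq']
  obtain ⟨e, he, hxe⟩ := exists_unit_tangent (by omega : 1 ≤ n) hx
  have h1 := hess x e e hx hxe hxe
  rw [hzero.1 x e hx he hxe, real_inner_self_eq_norm_sq, he, metricCoeff, hzero.2, one_pow,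
    mul_one, zero_pow two_ne_zero, zero_div, sub_zero] at h1
  linarith

end Constant

/-- **Uniqueness of constant solutions, case `0 ≤ p < 2k`** (Lemma 5.1(1) of Luo–Wei):
for each constant `γ > 0` the equation `σ_k(A[φ]) = φ^{p-k} γ` has a unique even, uniformly
h-convex solution, namely a constant `φ = c > 1`. -/
theorem constant_solution_p_lt_two_k (n k : ℕ) (p γ : ℝ)
    (hn : 2 ≤ n) (hk1 : 1 ≤ k) (hk2 : k ≤ n - 1)
    (hp0 : 0 ≤ p) (hp2 : p < 2 * (k : ℝ)) (hγ : 0 < γ) :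
    ∃ c : ℝ, 1 < c ∧
      UnifHConvex (fun _ : Euc n => c) ∧
      SolvesCM n k p (fun _ => γ) (fun _ => c) ∧
      ∀ φ : Euc n → ℝ, Homog0 φ → SmoothFn φ → EvenFn φ →
        (∀ x ∈ uSphere n, 0 < φ x) → UnifHConvex φ →
        SolvesCM n k p (fun _ => γ) φ →
        ∀ x ∈ uSphere n, φ x = c := by
  obtain ⟨m, rfl⟩ : ∃ m, k = m + 1 := ⟨k - 1, by omega⟩
  have hm : m + 2 ≤ n := by omega
  have hk0 : (0 : ℝ) < (m : ℝ) + 1 := by positivity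
  push_cast at hp2
  have hC : (0 : ℝ) < n.choose (m + 1) := by exact_mod_cast Nat.choose_pos (by omega)
  have hq : p = p / (m + 1) * (m + 1) := (div_mul_cancel₀ p hk0.ne').symm
  have hq0 : 0 ≤ p / (m + 1) := div_nonneg hp0 hk0.le
  have hq2 : p / (m + 1) < 2 := (div_lt_iff₀ hk0).2 hp2
  obtain ⟨c₀, hc₀, hcγ⟩ : ∃ c₀ : ℝ, 0 < c₀ ∧ (n.choose (m + 1) : ℝ) * c₀ ^ (m + 1) = γ := by
    refine ⟨(γ / n.choose (m + 1)) ^ (((m + 1 : ℕ) : ℝ)⁻¹), by positivity, ?_⟩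
    rw [Real.rpow_inv_natCast_pow (by positivity) m.succ_ne_zero]
    field_simp
  obtain ⟨c, hc1, hc, huniq⟩ := exists_unique_scalar_solution hq0 hq2 hc₀
  have hc0 : 0 < c := one_pos.trans hc1
  refine ⟨c, hc1, unifHConvex_const hc1, fun x hx e he => ?_,
    fun φ hh hs hev hpos hconv hsol x hx => ?_⟩
  · rw [sigmaMat_amat_const (mem_uSphere.1 hx) he, hc, mul_pow, ← mul_assoc, hcγ, mul_comm,
      ← Real.rpow_mul_natCast hc0.le, sub_mul]
    push_cast
    rw [← hq, one_mul]
  · have hone : ∀ y ∈ uSphere n, 1 < φ y := fun y hy =>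
      hh.one_lt hs hev hpos hconv (by omega) (mem_uSphere.1 hy)
    exact huniq _ (hone x hx)
      (hh.scalar_eq hm hq0 hq hc₀ hcγ hs hev hone hconv hsol (mem_uSphere.1 hx))
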